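/- arXiv:2603.29567 — 4 statements merged into one kernel-verified Lean document; each statement's English description precedes it below -/
import Mathlib

section
/- Let (χ_n) ⊂ IP(μ) be a sequence of admissible irrigation plans and (ε_n) positive numbers such that χ_n → χ ∈ IP(μ) and ε_n → 0 as n → ∞. Assume the stopping times satisfy ∫_Θ T_n(θ) dθ ≤ C for a uniform constant C > 0 and all n ≥ 1. Then for a.e. θ ∈ Θ and every t ∈ ℝ₊, limsup_{n→∞} W_{ε_n}(χ_n(θ,t), χ_n) ≤ |χ(θ,t)|_χ. -/
open MeasureTheory Filter Topology
open scoped ENNReal NNReal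

noncomputable section

/-- Euclidean space `ℝ^d`. -/
abbrev Euc (d : ℕ) : Type := EuclideanSpace ℝ (Fin d)

/-- `Θ = [0, M]` where `M = μ(ℝ^d)` is the total mass. -/
def Theta {d : ℕ} (μ : Measure (Euc d)) : Set ℝ := Set.Icc 0 (μ Set.univ).toReal

/-- The stopping time `T(θ)` of a Lagrangian path. -/
def stopTime {d : ℕ} (χ : ℝ → ℝ → Euc d) (θ : ℝ) : ℝ :=
  sInf {t : ℝ | 0 < t ∧ ∀ t' ≥ t, χ θ t' = χ θ t}

/-- An admissible irrigation plan for the measure `μ`: measurable, `1`-Lipschitz and eventually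
constant paths, all starting at the origin, whose final positions push the Lebesgue measure
on `Θ = [0,M]` forward onto `μ`. -/
structure IsIrrigPlan {d : ℕ} (μ : Measure (Euc d)) (χ : ℝ → ℝ → Euc d) : Prop where
  measurable : Measurable (Function.uncurry χ)
  lipschitz : ∀ θ ∈ Theta μ, LipschitzWith 1 (χ θ)
  eventuallyConst : ∀ θ ∈ Theta μ, ∃ t, 0 < t ∧ ∀ t' ≥ t, χ θ t' = χ θ t
  init : ∀ θ ∈ Theta μ, χ θ 0 = 0
  pushforward :
    Measure.map (fun θ => χ θ (stopTime χ θ)) (volume.restrict (Theta μ)) = μ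

/-- The multiplicity `|x|_χ`: the measure of the set of particles passing through `x`. -/
def mult {d : ℕ} (μ : Measure (Euc d)) (χ : ℝ → ℝ → Euc d) (x : Euc d) : ℝ≥0∞ :=
  volume {θ ∈ Theta μ | ∃ t, 0 ≤ t ∧ χ θ t = x}

/-- The `α`-irrigation cost `E^α(χ)`. -/
def irrCost {d : ℕ} (μ : Measure (Euc d)) (α : ℝ) (χ : ℝ → ℝ → Euc d) : ℝ≥0∞ :=
  ∫⁻ θ in Theta μ, ∫⁻ t in Set.Ici (0:ℝ),
    (mult μ χ (χ θ t)) ^ (α - 1) * (‖deriv (χ θ) t‖₊ : ℝ≥0∞)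

/-- `ρ(θ,x) = min_{t ≥ 0} |χ(θ,t) − x|`. -/
def pathInfDist {d : ℕ} (χ : ℝ → ℝ → Euc d) (θ : ℝ) (x : Euc d) : ℝ :=
  ⨅ t : Set.Ici (0:ℝ), dist (χ θ (t : ℝ)) x

/-- A mollifying kernel: a nonnegative, non-increasing, Lipschitz function on `ℝ₊`
with `J(0) = 1` and `J(r) → 0` as `r → ∞`. -/
def MollKernel (J : ℝ → ℝ) : Prop :=
  (∀ r, 0 ≤ r → 0 ≤ J r) ∧ AntitoneOn J (Set.Ici 0) ∧
    (∃ K : ℝ≥0, LipschitzOnWith K J (Set.Ici 0)) ∧ J 0 = 1 ∧ Tendsto J atTop (𝓝 0)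

/-- The mollified multiplicity `W_ε(x,χ) = ∫_Θ J_ε(min_{t≥0} |χ(θ,t) − x|) dθ`. -/
def Wmol {d : ℕ} (μ : Measure (Euc d)) (J : ℝ → ℝ) (ε : ℝ) (χ : ℝ → ℝ → Euc d)
    (x : Euc d) : ℝ≥0∞ :=
  ∫⁻ θ in Theta μ, ENNReal.ofReal (J (pathInfDist χ θ x / ε))

/-- The mollified irrigation cost `E^α_ε(χ)`. -/
def Emol {d : ℕ} (μ : Measure (Euc d)) (J : ℝ → ℝ) (α ε : ℝ)
    (χ : ℝ → ℝ → Euc d) : ℝ≥0∞ :=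
  ∫⁻ θ in Theta μ, ∫⁻ t in Set.Ici (0:ℝ),
    (Wmol μ J ε χ (χ θ t)) ^ (α - 1) * (‖deriv (χ θ) t‖₊ : ℝ≥0∞)

/-- The distance `d(γ₀,γ₁) = sup_{k ≥ 1} (1/k) ‖γ₀ − γ₁‖_{L^∞([0,k])}` between paths. -/
def dPath {d : ℕ} (γ₀ γ₁ : ℝ → Euc d) : ℝ :=
  ⨆ k : ℕ+, (1 / ((k : ℕ) : ℝ)) *
    ⨆ t : Set.Icc (0:ℝ) ((k : ℕ) : ℝ), dist (γ₀ (t : ℝ)) (γ₁ (t : ℝ))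

/-- Convergence `χ_n → χ` of irrigation plans: `d(χ_n(θ,·), χ(θ,·)) → 0` for a.e. `θ ∈ Θ`. -/
def PlansTendsto {d : ℕ} (μ : Measure (Euc d)) (χs : ℕ → ℝ → ℝ → Euc d)
    (χ : ℝ → ℝ → Euc d) : Prop :=
  ∀ᵐ θ ∂(volume.restrict (Theta μ)),
    Tendsto (fun n => dPath (χs n θ) (χ θ)) atTop (𝓝 0)

/-- The plan `χ` is parameterized by arc-length: for a.e. `t`, `|∂_t χ(θ,t)| = 1` for
`0 < t < T(θ)` and `|∂_t χ(θ,t)| = 0` for `t > T(θ)`. -/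
def ArcLength {d : ℕ} (μ : Measure (Euc d)) (χ : ℝ → ℝ → Euc d) : Prop :=
  ∀ θ ∈ Theta μ, ∀ᵐ t ∂(volume : Measure ℝ),
    (0 < t → t < stopTime χ θ → ‖deriv (χ θ) t‖ = 1) ∧
    (stopTime χ θ < t → ‖deriv (χ θ) t‖ = 0)

/-- An alternative mollifying kernel: smooth, positive, strictly decreasing on `ℝ₊`,
with `1 ≤ ∫₀^∞ J(r) dr < ∞`. -/
def MollKernel2 (J : ℝ → ℝ) : Prop :=
  ContDiffOn ℝ (⊤ : ℕ∞) J (Set.Ici 0) ∧ (∀ r, 0 ≤ r → 0 < J r) ∧ StrictAntiOn J (Set.Ici 0) ∧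
    IntegrableOn J (Set.Ioi 0) volume ∧ 1 ≤ ∫ r in Set.Ioi (0:ℝ), J r

/-- The alternative mollified multiplicity
`W̃_ε(x,χ) = ∫_Θ min{1, ∫₀^∞ (1/ε) J_ε(|χ(θ,t) − x|) |∂_t χ(θ,t)| dt} dθ`. -/
def Wtil {d : ℕ} (μ : Measure (Euc d)) (J : ℝ → ℝ) (ε : ℝ) (χ : ℝ → ℝ → Euc d)
    (x : Euc d) : ℝ≥0∞ :=
  ∫⁻ θ in Theta μ,
    min 1 (∫⁻ t in Set.Ici (0:ℝ),
      ENNReal.ofReal ((1 / ε) * J (dist (χ θ t) x / ε)) * (‖deriv (χ θ) t‖₊ : ℝ≥0∞))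

/-- The alternative mollified irrigation cost `Ẽ^α_ε(χ)`. -/
def Etil {d : ℕ} (μ : Measure (Euc d)) (J : ℝ → ℝ) (α ε : ℝ)
    (χ : ℝ → ℝ → Euc d) : ℝ≥0∞ :=
  ∫⁻ θ in Theta μ, ∫⁻ t in Set.Ici (0:ℝ),
    (Wtil μ J ε χ (χ θ t)) ^ (α - 1) * (‖deriv (χ θ) t‖₊ : ℝ≥0∞)


/-- Paths that agree at time `0` and are `1`-Lipschitz are uniformly close on `[0,k]` when they
are close for `dPath`. -/
lemma dist_le_mul_dPath {d : ℕ} {γ₀ γ₁ : ℝ → Euc d} (h₀ : LipschitzWith 1 γ₀)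
    (h₁ : LipschitzWith 1 γ₁) (h : γ₀ 0 = γ₁ 0) {k : ℕ} (hk : 0 < k) {s : ℝ} (hs : 0 ≤ s)
    (hsk : s ≤ k) : dist (γ₀ s) (γ₁ s) ≤ k * dPath γ₀ γ₁ := by
  have hbound : ∀ (m : ℕ) (t : Set.Icc (0 : ℝ) (m : ℝ)), dist (γ₀ t) (γ₁ t) ≤ 2 * m := by
    rintro m ⟨t, ht0, htm⟩
    have e₀ := h₀.dist_le_mul t 0
    have e₁ := h₁.dist_le_mul t 0
    have htri := dist_triangle_right (γ₀ t) (γ₁ t) (γ₀ 0)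
    rw [Real.dist_eq, sub_zero, abs_of_nonneg ht0, NNReal.coe_one, one_mul] at e₀ e₁
    rw [← h] at e₁
    change dist (γ₀ t) (γ₁ t) ≤ 2 * m
    linarith
  have hbdd : BddAbove (Set.range fun m : ℕ+ => (1 / ((m : ℕ) : ℝ)) *
      ⨆ t : Set.Icc (0:ℝ) ((m : ℕ) : ℝ), dist (γ₀ (t : ℝ)) (γ₁ (t : ℝ))) := by
    refine ⟨2, ?_⟩
    rintro _ ⟨m, rfl⟩
    have hm : (0 : ℝ) < (m : ℕ) := by exact_mod_cast m.pos
    have hsup := Real.iSup_le (hbound m) (by positivity)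
    change 1 / ((m : ℕ) : ℝ) * _ ≤ 2
    rw [one_div, inv_mul_le_iff₀ hm]
    linarith
  have hsup := le_ciSup hbdd (⟨k, hk⟩ : ℕ+)
  have hk' : (0 : ℝ) < k := by exact_mod_cast hk
  have hpt := le_ciSup (f := fun t : Set.Icc (0:ℝ) (k : ℝ) => dist (γ₀ (t : ℝ)) (γ₁ (t : ℝ)))
    ⟨2 * k, by rintro _ ⟨t, rfl⟩; exact hbound k t⟩ ⟨s, hs, hsk⟩
  have hsup' : 1 / (k : ℝ) * (⨆ t : Set.Icc (0:ℝ) (k : ℝ), dist (γ₀ (t : ℝ)) (γ₁ (t : ℝ)))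
      ≤ dPath γ₀ γ₁ := hsup
  rw [one_div, inv_mul_le_iff₀ hk'] at hsup'
  exact hpt.trans hsup'

/-- Pointwise convergence of paths along a `dPath`-convergent sequence. -/
lemma tendsto_of_tendsto_dPath {d : ℕ} {γs : ℕ → ℝ → Euc d} {γ : ℝ → Euc d}
    (hs : ∀ n, LipschitzWith 1 (γs n)) (h : LipschitzWith 1 γ) (h0 : ∀ n, γs n 0 = γ 0)
    (hlim : Tendsto (fun n => dPath (γs n) γ) atTop (𝓝 0)) {t : ℝ} (ht : 0 ≤ t) :
    Tendsto (fun n => γs n t) atTop (𝓝 (γ t)) := by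
  rw [tendsto_iff_dist_tendsto_zero]
  have hlim' : Tendsto (fun n => ((⌈t⌉₊ + 1 : ℕ) : ℝ) * dPath (γs n) γ) atTop (𝓝 0) := by
    simpa using hlim.const_mul ((⌈t⌉₊ + 1 : ℕ) : ℝ)
  refine squeeze_zero (fun n => dist_nonneg) (fun n => ?_) hlim'
  refine dist_le_mul_dPath (hs n) h (h0 n) (Nat.succ_pos _) ht ?_
  push_cast
  linarith [Nat.le_ceil t]

/-- The distance from a point to a path, computed along rational times. -/
def ratInfDist {d : ℕ} (χ : ℝ → ℝ → Euc d) (θ : ℝ) (x : Euc d) : ℝ :=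
  ⨅ q : ℚ, dist (χ θ |(q : ℝ)|) x

lemma ratInfDist_nonneg {d : ℕ} (χ : ℝ → ℝ → Euc d) (θ : ℝ) (x : Euc d) :
    0 ≤ ratInfDist χ θ x :=
  Real.iInf_nonneg fun _ => dist_nonneg

lemma measurable_ratInfDist {d : ℕ} {χ : ℝ → ℝ → Euc d} (hχ : Measurable (Function.uncurry χ))
    (x : Euc d) : Measurable fun θ => ratInfDist χ θ x := by
  refine Measurable.iInf fun q => ?_
  have : Measurable fun θ => χ θ |(q : ℝ)| := hχ.comp (measurable_id.prodMk measurable_const)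
  exact this.dist measurable_const

lemma ratInfDist_le_pathInfDist {d : ℕ} {χ : ℝ → ℝ → Euc d} {θ : ℝ} (hχ : Continuous (χ θ))
    (x : Euc d) : ratInfDist χ θ x ≤ pathInfDist χ θ x := by
  refine le_ciInf fun t => ?_
  have hclosed : IsClosed {s : ℝ | ratInfDist χ θ x ≤ dist (χ θ |s|) x} :=
    isClosed_le continuous_const ((hχ.comp continuous_abs).dist continuous_const)
  have hall : ratInfDist χ θ x ≤ dist (χ θ |(t : ℝ)|) x :=
    Rat.denseRange_cast.induction_on (p := fun s : ℝ => ratInfDist χ θ x ≤ dist (χ θ |s|) x)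
      (t : ℝ) hclosed fun q => ciInf_le ⟨0, by rintro _ ⟨q, rfl⟩; exact dist_nonneg⟩ q
  rwa [abs_of_nonneg t.2] at hall

/-- The particles that are at rest at all rational times after `k`. -/
def restSet {d : ℕ} (χ : ℝ → ℝ → Euc d) (k : ℝ) : Set ℝ :=
  {θ | ∀ q : ℚ, k ≤ q → χ θ q = χ θ k}

lemma measurableSet_restSet {d : ℕ} {χ : ℝ → ℝ → Euc d}
    (hχ : Measurable (Function.uncurry χ)) (k : ℝ) : MeasurableSet (restSet χ k) := by
  have hm : ∀ t, Measurable fun θ => χ θ t := fun t =>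
    hχ.comp (measurable_id.prodMk measurable_const)
  have : restSet χ k = ⋂ (q : ℚ) (_ : k ≤ q), {θ | χ θ q = χ θ k} := by
    ext θ; simp [restSet]
  rw [this]
  exact MeasurableSet.iInter fun q => MeasurableSet.iInter fun _ =>
    measurableSet_eq_fun (hm q) (hm k)

lemma le_stopTime_of_notMem_restSet {d : ℕ} {μ : Measure (Euc d)} {χ : ℝ → ℝ → Euc d}
    (hχ : IsIrrigPlan μ χ) {k θ : ℝ} (hθ : θ ∈ Theta μ) (h : θ ∉ restSet χ k) :
    k ≤ stopTime χ θ := by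
  refine le_csInf (hχ.eventuallyConst θ hθ) ?_
  rintro t ⟨-, ht⟩
  by_contra! hlt
  exact h fun q hq => (ht q (hlt.le.trans hq)).trans (ht k hlt.le).symm

/-- Markov's inequality for the stopping time. -/
lemma volume_restSet_compl_le {d : ℕ} {μ : Measure (Euc d)} {χ : ℝ → ℝ → Euc d}
    (hχ : IsIrrigPlan μ χ) {C k : ℝ} (hk : 0 < k)
    (hT : ∫⁻ θ in Theta μ, ENNReal.ofReal (stopTime χ θ) ≤ ENNReal.ofReal C) :
    volume.restrict (Theta μ) (restSet χ k)ᶜ ≤ ENNReal.ofReal (C / k) := by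
  have hS := (measurableSet_restSet hχ.measurable k).compl
  have hmul : ENNReal.ofReal k * volume.restrict (Theta μ) (restSet χ k)ᶜ ≤ ENNReal.ofReal C := by
    rw [← lintegral_indicator_const hS]
    refine (setLIntegral_mono' measurableSet_Icc fun θ hθ => ?_).trans hT
    by_cases h : θ ∈ restSet χ k
    · simp [h]
    · simpa [h] using ENNReal.ofReal_le_ofReal (le_stopTime_of_notMem_restSet hχ hθ h)
  rw [ENNReal.ofReal_div_of_pos hk, ENNReal.le_div_iff_mul_le (by simp [hk]) (by simp), mul_comm]
  exact hmul

/-- A point that is not visited by an eventually constant path lies at positive distance. -/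
lemma exists_pos_le_dist {d : ℕ} {γ : ℝ → Euc d} (hγ : Continuous γ)
    (hconst : ∃ t, 0 < t ∧ ∀ t' ≥ t, γ t' = γ t) {x : Euc d} (hx : ¬ ∃ t, 0 ≤ t ∧ γ t = x) :
    ∃ c > 0, ∀ s, 0 ≤ s → c ≤ dist (γ s) x := by
  obtain ⟨T, hT, hTc⟩ := hconst
  obtain ⟨s₀, hs₀, hmin⟩ := (isCompact_Icc (a := (0 : ℝ)) (b := T)).exists_isMinOn
    ⟨0, le_rfl, hT.le⟩ (hγ.dist continuous_const : Continuous fun s => dist (γ s) x).continuousOn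
  refine ⟨dist (γ s₀) x, dist_pos.2 fun h => hx ⟨s₀, hs₀.1, h⟩, fun s hs => ?_⟩
  rcases le_total s T with hsT | hsT
  · exact hmin ⟨hs, hsT⟩
  · rw [hTc s hsT]
    exact hmin ⟨hT.le, le_rfl⟩

/-- If `γs n` converges to a path staying at distance at least `c` from `x`, then eventually
`γs n` is at distance at least `c / 2` from `xs n → x`, among paths at rest after time `k`. -/
lemma eventually_le_ratInfDist {d : ℕ} {χs : ℕ → ℝ → ℝ → Euc d} {χ : ℝ → ℝ → Euc d} {θ : ℝ}
    (hs : ∀ n, LipschitzWith 1 (χs n θ)) (h : LipschitzWith 1 (χ θ))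
    (h0 : ∀ n, χs n θ 0 = χ θ 0)
    (hlim : Tendsto (fun n => dPath (χs n θ) (χ θ)) atTop (𝓝 0))
    {xs : ℕ → Euc d} {x : Euc d} (hx : Tendsto xs atTop (𝓝 x)) {k : ℕ} (hk : 0 < k)
    {c : ℝ} (hc : 0 < c) (hdist : ∀ s, 0 ≤ s → c ≤ dist (χ θ s) x) :
    ∀ᶠ n in atTop, θ ∈ restSet (χs n) k → c / 2 ≤ ratInfDist (χs n) θ (xs n) := by
  have hlim' : Tendsto (fun n => (k : ℝ) * dPath (χs n θ) (χ θ)) atTop (𝓝 0) := by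
    simpa using hlim.const_mul (k : ℝ)
  filter_upwards [hlim'.eventually_lt_const (show 0 < c / 4 by positivity),
    (tendsto_iff_dist_tendsto_zero.1 hx).eventually_lt_const (show 0 < c / 4 by positivity)]
    with n hn hxn hrest
  have key : ∀ s : ℝ, 0 ≤ s → s ≤ k → c / 2 ≤ dist (χs n θ s) (xs n) := by
    intro s hs0 hsk
    have e₁ := dist_le_mul_dPath (hs n) h (h0 n) hk hs0 hsk
    have e₂ := dist_triangle4_right (χ θ s) x (χs n θ s) (xs n)
    have e₃ := hdist s hs0
    have e₄ := dist_triangle4 (χ θ s) (χs n θ s) (xs n) x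
    rw [dist_comm] at e₁
    linarith
  refine le_ciInf fun q => ?_
  rcases le_total |(q : ℝ)| k with hq | hq
  · exact key _ (abs_nonneg _) hq
  · have hcast : ((|q| : ℚ) : ℝ) = |(q : ℝ)| := Rat.cast_abs q
    have := hrest |q| (by rwa [hcast])
    rw [← hcast, this]
    exact key k (Nat.cast_nonneg k) le_rfl

/-- The mollified indicator of the paths through `x`, computed along rational times. -/
def molIndicator {d : ℕ} (J : ℝ → ℝ) (ε : ℝ) (χ : ℝ → ℝ → Euc d) (x : Euc d) (θ : ℝ) : ℝ≥0∞ :=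
  ENNReal.ofReal (J (ratInfDist χ θ x / ε))

lemma MollKernel.le_one {J : ℝ → ℝ} (hJ : MollKernel J) {r : ℝ} (hr : 0 ≤ r) : J r ≤ 1 :=
  hJ.2.2.2.1 ▸ hJ.2.1 Set.self_mem_Ici hr hr

lemma molIndicator_le_one {d : ℕ} {J : ℝ → ℝ} (hJ : MollKernel J) {ε : ℝ} (hε : 0 < ε)
    (χ : ℝ → ℝ → Euc d) (x : Euc d) (θ : ℝ) : molIndicator J ε χ x θ ≤ 1 :=
  ENNReal.ofReal_le_one.2 (hJ.le_one (div_nonneg (ratInfDist_nonneg χ θ x) hε.le))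

lemma measurable_molIndicator {d : ℕ} {J : ℝ → ℝ} (hJ : MollKernel J) {ε : ℝ} (hε : 0 < ε)
    {χ : ℝ → ℝ → Euc d} (hχ : Measurable (Function.uncurry χ)) (x : Euc d) :
    Measurable (molIndicator J ε χ x) := by
  have hanti : Antitone fun r => J (max 0 r) := fun a b hab =>
    hJ.2.1 (le_max_left 0 a) (le_max_left 0 b) (max_le_max_left 0 hab)
  have : molIndicator J ε χ x =
      fun θ => ENNReal.ofReal ((fun r => J (max 0 r)) (ratInfDist χ θ x / ε)) := by
    funext θ
    simp only [molIndicator, max_eq_right (div_nonneg (ratInfDist_nonneg χ θ x) hε.le)]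
  rw [this]
  exact (hanti.measurable.comp ((measurable_ratInfDist hχ x).div_const ε)).ennreal_ofReal

/-- Up to particles with a large stopping time, the mollified multiplicity is the integral of
the mollified indicator over particles at rest after time `k`. -/
lemma Wmol_le_add {d : ℕ} {μ : Measure (Euc d)} {J : ℝ → ℝ} (hJ : MollKernel J) {ε : ℝ}
    (hε : 0 < ε) {χ : ℝ → ℝ → Euc d} (hχ : IsIrrigPlan μ χ) {C k : ℝ} (hk : 0 < k)
    (hT : ∫⁻ θ in Theta μ, ENNReal.ofReal (stopTime χ θ) ≤ ENNReal.ofReal C) (x : Euc d) :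
    Wmol μ J ε χ x ≤
      (∫⁻ θ in Theta μ, (restSet χ k).indicator (molIndicator J ε χ x) θ) +
        ENNReal.ofReal (C / k) := by
  have hS := measurableSet_restSet hχ.measurable k
  refine le_trans ?_ (add_le_add_right (volume_restSet_compl_le hχ hk hT) _)
  rw [← lintegral_indicator_one hS.compl,
    ← lintegral_add_left ((measurable_molIndicator hJ hε hχ.measurable x).indicator hS)]
  refine setLIntegral_mono' measurableSet_Icc fun θ hθ => ?_
  have hle := ratInfDist_le_pathInfDist (hχ.lipschitz θ hθ).continuous x
  have hJle : ENNReal.ofReal (J (pathInfDist χ θ x / ε)) ≤ molIndicator J ε χ x θ :=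
    ENNReal.ofReal_le_ofReal (hJ.2.1 (div_nonneg (ratInfDist_nonneg χ θ x) hε.le)
      (div_nonneg ((ratInfDist_nonneg χ θ x).trans hle) hε.le)
      (div_le_div_of_nonneg_right hle hε.le))
  by_cases h : θ ∈ restSet χ k
  · simpa [h] using hJle
  · simpa [h] using hJle.trans (molIndicator_le_one hJ hε χ x θ)

/-- Pointwise upper semicontinuity of the mollified indicators. -/
lemma limsup_indicator_molIndicator_le {d : ℕ} {J : ℝ → ℝ} (hJ : MollKernel J)
    {εs : ℕ → ℝ} (hεs : ∀ n, 0 < εs n) (hεs0 : Tendsto εs atTop (𝓝 0))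
    {χs : ℕ → ℝ → ℝ → Euc d} {χ : ℝ → ℝ → Euc d} {θ : ℝ}
    (hs : ∀ n, LipschitzWith 1 (χs n θ)) (h : LipschitzWith 1 (χ θ))
    (h0 : ∀ n, χs n θ 0 = χ θ 0) (hconst : ∃ t, 0 < t ∧ ∀ t' ≥ t, χ θ t' = χ θ t)
    (hlim : Tendsto (fun n => dPath (χs n θ) (χ θ)) atTop (𝓝 0))
    {xs : ℕ → Euc d} {x : Euc d} (hx : Tendsto xs atTop (𝓝 x)) {k : ℕ} (hk : 0 < k) :
    limsup (fun n => (restSet (χs n) k).indicator (molIndicator J (εs n) (χs n) (xs n)) θ) atTop ≤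
      {θ | ∃ t, 0 ≤ t ∧ χ θ t = x}.indicator 1 θ := by
  by_cases hA : ∃ t, 0 ≤ t ∧ χ θ t = x
  · have hmem : θ ∈ {θ | ∃ t, 0 ≤ t ∧ χ θ t = x} := hA
    rw [Set.indicator_of_mem hmem]
    exact limsup_le_of_le (h := Eventually.of_forall fun n =>
      (Set.indicator_le_self _ _ θ).trans (molIndicator_le_one hJ (hεs n) _ _ θ))
  · obtain ⟨c, hc, hdist⟩ := exists_pos_le_dist h.continuous hconst hA
    have hJ0 : Tendsto (fun n => ENNReal.ofReal (J (c / 2 / εs n))) atTop (𝓝 0) := by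
      have hdiv : Tendsto (fun n => c / 2 / εs n) atTop atTop :=
        (tendsto_inv_nhdsGT_zero.comp (tendsto_nhdsWithin_iff.2
          ⟨hεs0, Eventually.of_forall hεs⟩)).const_mul_atTop (half_pos hc)
      simpa using ENNReal.tendsto_ofReal (hJ.2.2.2.2.comp hdiv)
    refine le_trans (limsup_le_limsup ?_) (hJ0.limsup_eq.le.trans zero_le)
    filter_upwards [eventually_le_ratInfDist hs h h0 hlim hx hk hc hdist] with n hn
    refine Set.indicator_apply_le' (fun hθ => ENNReal.ofReal_le_ofReal ?_) fun _ => zero_le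
    exact hJ.2.1 (div_nonneg (half_pos hc).le (hεs n).le)
      (div_nonneg (ratInfDist_nonneg _ _ _) (hεs n).le)
      (div_le_div_of_nonneg_right (hn hθ) (hεs n).le)

/-- upper semicontinuity of mollified multiplicities along plans
`χ_n → χ` with mollification parameters `ε_n → 0`. -/
theorem mollified_mult_limsup_le_mult {d : ℕ} (hd : 1 ≤ d)
    (μ : Measure (Euc d)) [IsFiniteMeasure μ]
    (hsupp : ∃ R : ℝ, μ (Metric.closedBall 0 R)ᶜ = 0)
    (J : ℝ → ℝ) (hJ : MollKernel J)
    (εs : ℕ → ℝ) (hεs : ∀ n, 0 < εs n) (hεs0 : Tendsto εs atTop (𝓝 0))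
    (χs : ℕ → ℝ → ℝ → Euc d) (χ : ℝ → ℝ → Euc d)
    (hχs : ∀ n, IsIrrigPlan μ (χs n)) (hχ : IsIrrigPlan μ χ)
    (hconv : PlansTendsto μ χs χ)
    (C : ℝ) (hC : 0 < C)
    (hT : ∀ n, ∫⁻ θ in Theta μ, ENNReal.ofReal (stopTime (χs n) θ) ≤ ENNReal.ofReal C) :
    ∀ᵐ θ ∂(volume.restrict (Theta μ)), ∀ t : ℝ, 0 ≤ t →
      Filter.limsup (fun n => Wmol μ J (εs n) (χs n) (χs n θ t)) atTop
        ≤ mult μ χ (χ θ t) := by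
  have hlip : ∀ n, ∀ θ ∈ Theta μ, LipschitzWith 1 (χs n θ) := fun n => (hχs n).lipschitz
  have hinit : ∀ n, ∀ θ ∈ Theta μ, χs n θ 0 = χ θ 0 := fun n θ hθ =>
    ((hχs n).init θ hθ).trans (hχ.init θ hθ).symm
  have hmem : ∀ᵐ θ ∂(volume.restrict (Theta μ)), θ ∈ Theta μ :=
    ae_restrict_mem measurableSet_Icc
  filter_upwards [hconv, hmem] with θ₀ hlim₀ hθ₀ t ht
  set x := χ θ₀ t
  have hx : Tendsto (fun n => χs n θ₀ t) atTop (𝓝 x) :=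
    tendsto_of_tendsto_dPath (fun n => hlip n θ₀ hθ₀) (hχ.lipschitz θ₀ hθ₀)
      (fun n => hinit n θ₀ hθ₀) hlim₀ ht
  have hbound : ∀ k : ℕ, limsup (fun n => Wmol μ J (εs n) (χs n) (χs n θ₀ t)) atTop ≤
      mult μ χ x + ENNReal.ofReal (C / ((k + 1 : ℕ) : ℝ)) := by
    intro k
    have hk : (0 : ℝ) < ((k + 1 : ℕ) : ℝ) := by positivity
    set f : ℕ → ℝ → ℝ≥0∞ := fun n => (restSet (χs n) ((k + 1 : ℕ) : ℝ)).indicator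
      (molIndicator J (εs n) (χs n) (χs n θ₀ t))
    have hfatou : limsup (fun n => ∫⁻ θ in Theta μ, f n θ) atTop ≤ mult μ χ x := by
      calc limsup (fun n => ∫⁻ θ in Theta μ, f n θ) atTop
          ≤ ∫⁻ θ in Theta μ, limsup (fun n => f n θ) atTop := by
            refine limsup_lintegral_le 1 (fun n => (measurable_molIndicator hJ (hεs n)
              (hχs n).measurable _).indicator (measurableSet_restSet (hχs n).measurable _))
              (fun n => Eventually.of_forall fun θ => (Set.indicator_le_self _ _ θ).trans
                (molIndicator_le_one hJ (hεs n) _ _ θ)) ?_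
            simp [Theta]
        _ ≤ ∫⁻ θ in Theta μ, {θ | ∃ t, 0 ≤ t ∧ χ θ t = x}.indicator 1 θ := by
            refine lintegral_mono_ae ?_
            filter_upwards [hconv, hmem] with θ hlim hθ
            exact limsup_indicator_molIndicator_le hJ hεs hεs0 (fun n => hlip n θ hθ)
              (hχ.lipschitz θ hθ) (fun n => hinit n θ hθ) (hχ.eventuallyConst θ hθ) hlim hx
              k.succ_pos
        _ ≤ volume.restrict (Theta μ) {θ | ∃ t, 0 ≤ t ∧ χ θ t = x} :=
            lintegral_indicator_one_le _
        _ = mult μ χ x := by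
            rw [Measure.restrict_apply' (show MeasurableSet (Theta μ) from measurableSet_Icc),
              Set.inter_comm]
            rfl
    calc limsup (fun n => Wmol μ J (εs n) (χs n) (χs n θ₀ t)) atTop
        ≤ limsup (fun n => (∫⁻ θ in Theta μ, f n θ) +
            ENNReal.ofReal (C / ((k + 1 : ℕ) : ℝ))) atTop :=
          limsup_le_limsup (Eventually.of_forall fun n =>
            Wmol_le_add hJ (hεs n) (hχs n) hk (hT n) _)
      _ = limsup (fun n => ∫⁻ θ in Theta μ, f n θ) atTop +
            ENNReal.ofReal (C / ((k + 1 : ℕ) : ℝ)) :=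
          limsup_add_const _ _ _ (by isBoundedDefault) (by isBoundedDefault)
      _ ≤ _ := by gcongr
  have hzero : Tendsto (fun k : ℕ => mult μ χ x + ENNReal.ofReal (C / ((k + 1 : ℕ) : ℝ))) atTop
      (𝓝 (mult μ χ x)) := by
    have := ENNReal.tendsto_ofReal
      ((tendsto_const_div_atTop_nhds_zero_nat C).comp (tendsto_add_atTop_nat 1))
    simpa using this.const_add (mult μ χ x)
  exact ge_of_tendsto' hzero hbound

end
end

section
/- Let χ ∈ IP(μ) be an admissible irrigation plan and x ∈ ℝ^d \ {0}. Then the alternative mollified multiplicity converges to the multiplicity as the mollification parameter tends to zero: lim_{ε→0+} W̃_ε(x,χ) = |x|_χ. -/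
open MeasureTheory Filter Topology
open scoped ENNReal NNReal

noncomputable section

/-- An eventually constant continuous curve avoiding `x` on `[0, ∞)` stays at positive distance
from `x`. -/
lemma exists_pos_le_dist_of_eventually_const {E : Type*} [MetricSpace E] {γ : ℝ → E}
    (hγ : Continuous γ) {T : ℝ} (hT : 0 ≤ T) (hc : ∀ t ≥ T, γ t = γ T) {x : E} (hx : ∀ t, 0 ≤ t → γ t ≠ x) :
    ∃ δ > 0, ∀ t, 0 ≤ t → δ ≤ dist (γ t) x := by
  obtain ⟨u, hu, hmin⟩ := isCompact_Icc.exists_isMinOn (Set.nonempty_Icc.2 hT)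
    (hγ.dist continuous_const : Continuous fun t => dist (γ t) x).continuousOn
  refine ⟨dist (γ u) x, dist_pos.2 (hx u hu.1), fun t ht => ?_⟩
  rcases le_total t T with h | h
  · exact hmin ⟨ht, h⟩
  · rw [hc t h]
    exact hmin ⟨hT, le_rfl⟩

section PathLemmas

variable {E : Type*} [NormedAddCommGroup E] [NormedSpace ℝ E]

lemma tendsto_enorm_diff_quotient {f : ℝ → E} {t : ℝ} (hf : DifferentiableAt ℝ f t) :
    Tendsto (fun n : ℕ => ‖((1 : ℝ) / (n + 1))⁻¹ • (f (t + 1 / (n + 1)) - f t)‖ₑ) atTop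
      (𝓝 ‖deriv f t‖ₑ) := by
  have h₀ : Tendsto (fun n : ℕ => (1 : ℝ) / (n + 1)) atTop (𝓝[≠] 0) :=
    tendsto_nhdsWithin_iff.2 ⟨tendsto_one_div_add_atTop_nhds_zero_nat,
      Eventually.of_forall fun n => (Nat.one_div_pos_of_nat (n := n)).ne'⟩
  exact (hf.hasDerivAt.tendsto_slope_zero.comp h₀).enorm

/-- The weighted length of a measurable family of Lipschitz curves is a measurable function of
the parameter. -/
lemma aemeasurable_lintegral_mul_enorm_deriv [FiniteDimensional ℝ E] [MeasurableSpace E]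
    [BorelSpace E] {χ : ℝ → ℝ → E} {s : Set ℝ} {C : ℝ≥0} (hs : MeasurableSet s)
    (hm : Measurable (Function.uncurry χ)) (hL : ∀ θ ∈ s, LipschitzWith C (χ θ))
    {w : E → ℝ≥0∞} (hw : Measurable w) :
    AEMeasurable (fun θ => ∫⁻ t in Set.Ici (0:ℝ), w (χ θ t) * ‖deriv (χ θ) t‖ₑ)
      (volume.restrict s) := by
  have hsm (c : ℝ) : Measurable fun p : ℝ × ℝ => χ p.1 (p.2 + c) :=
    hm.comp (measurable_fst.prodMk (measurable_snd.add_const c))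
  have hm' : Measurable fun p : ℝ × ℝ => χ p.1 p.2 := hm
  let D : ℝ → ℝ → ℝ≥0∞ := fun θ t => limsup (fun n : ℕ =>
    ‖((1 : ℝ) / (n + 1))⁻¹ • (χ θ (t + 1 / (n + 1)) - χ θ t)‖ₑ) atTop
  have hD : Measurable fun p : ℝ × ℝ => w (χ p.1 p.2) * D p.1 p.2 :=
    (hw.comp hm').mul (Measurable.limsup fun n =>
      (((hsm _).sub hm').const_smul ((1 : ℝ) / (n + 1))⁻¹).enorm)
  refine ⟨fun θ => ∫⁻ t in Set.Ici (0:ℝ), w (χ θ t) * D θ t, hD.lintegral_prod_right', ?_⟩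
  filter_upwards [ae_restrict_mem hs] with θ hθ
  refine lintegral_congr_ae (ae_restrict_of_ae ?_)
  filter_upwards [(hL θ hθ).ae_differentiableAt_real] with t ht
  rw [← (tendsto_enorm_diff_quotient ht).limsup_eq]

/-- A curve ending at `x` has weighted length at least the integral of the radial weight over the
range of distances to `x`. -/
lemma ofReal_integral_le_lintegral_of_path [FiniteDimensional ℝ E] {γ : ℝ → E} {C B : ℝ≥0}
    (hγ : LipschitzWith C γ) {t₀ : ℝ} (ht₀ : 0 ≤ t₀) {K : ℝ → ℝ} (hK : Continuous K)
    (hKB : ∀ r, ‖K r‖ ≤ B) (hK0 : ∀ r, 0 ≤ K r) :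
    ENNReal.ofReal (∫ r in (0:ℝ)..dist (γ 0) (γ t₀), K r) ≤
      ∫⁻ t in Set.Ici (0:ℝ), ENNReal.ofReal (K (dist (γ t) (γ t₀))) * ‖deriv γ t‖ₑ := by
  let Φ : ℝ → ℝ := fun r => ∫ s in (0:ℝ)..r, K s
  have hΦ (r : ℝ) : HasDerivAt Φ (K r) r := hK.integral_hasStrictDerivAt 0 r |>.hasDerivAt
  have hΦL : LipschitzWith B Φ := lipschitzWith_of_nnnorm_deriv_le
    (fun r => (hΦ r).differentiableAt) fun r => by
      rw [(hΦ r).deriv]; exact hKB r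
  let g : ℝ → ℝ := fun t => dist (γ t) (γ t₀)
  have hg : LipschitzWith (1 * C) g := (LipschitzWith.dist_left (γ t₀)).comp hγ
  have hac : AbsolutelyContinuousOnInterval (Φ ∘ g) 0 t₀ :=
    (hΦL.comp hg).lipschitzOnWith.absolutelyContinuousOnInterval
  have hFTC := hac.integral_deriv_eq_sub
  have h1 : ENNReal.ofReal (Φ (g 0)) = ‖∫ t in (0:ℝ)..t₀, deriv (Φ ∘ g) t‖ₑ := by
    have h0 : 0 ≤ Φ (g 0) := intervalIntegral.integral_nonneg dist_nonneg fun r _ => hK0 r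
    have h2 : Φ (g t₀) = 0 := by simp [Φ, g]
    rw [hFTC, Function.comp_apply, Function.comp_apply, h2, zero_sub, enorm_neg,
      Real.enorm_of_nonneg h0]
  have h3 : ‖∫ t in (0:ℝ)..t₀, deriv (Φ ∘ g) t‖ₑ ≤ ∫⁻ t in Set.Ioc 0 t₀, ‖deriv (Φ ∘ g) t‖ₑ := by
    rw [intervalIntegral.integral_of_le ht₀]
    exact enorm_integral_le_lintegral_enorm _
  refine (h1.trans_le h3).trans ?_
  refine (lintegral_mono_set (Set.Ioc_subset_Ioi_self.trans Set.Ioi_subset_Ici_self)).trans ?_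
  refine lintegral_mono_ae (ae_restrict_of_ae ?_)
  filter_upwards [hγ.ae_differentiableAt_real, hg.ae_differentiableAt_real] with t ht hgt
  rw [((hΦ (g t)).comp t hgt.hasDerivAt).deriv, enorm_mul, Real.enorm_of_nonneg (hK0 _)]
  gcongr
  refine le_of_tendsto_of_tendsto' (tendsto_enorm_diff_quotient hgt)
    (tendsto_enorm_diff_quotient ht) fun n => ?_
  rw [enorm_smul, enorm_smul]
  gcongr
  rw [enorm_le_iff_norm_le, Real.norm_eq_abs, ← dist_eq_norm]
  exact abs_dist_sub_le _ _ _

lemma lintegral_mul_enorm_deriv_le {γ : ℝ → E} {C : ℝ≥0} (hγ : LipschitzWith C γ) {T : ℝ}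
    (hc : ∀ t ≥ T, γ t = γ T) {w : ℝ → ℝ≥0∞} {b : ℝ≥0∞} (hw : ∀ t, 0 ≤ t → w t ≤ b) :
    ∫⁻ t in Set.Ici (0:ℝ), w t * ‖deriv γ t‖ₑ ≤ b * (C * ENNReal.ofReal T) := by
  calc ∫⁻ t in Set.Ici (0:ℝ), w t * ‖deriv γ t‖ₑ
      ≤ ∫⁻ t in Set.Ici (0:ℝ), (Set.Iic T).indicator (fun _ => b * C) t := by
        refine setLIntegral_mono (measurable_const.indicator measurableSet_Iic) fun t ht => ?_
        by_cases h : t ≤ T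
        · rw [Set.indicator_of_mem (Set.mem_Iic.2 h)]
          gcongr
          · exact hw t ht
          · rw [enorm_le_coe]
            exact norm_deriv_le_of_lipschitz hγ
        · have : γ =ᶠ[𝓝 t] fun _ => γ T := by
            filter_upwards [lt_mem_nhds (not_le.1 h)] with u hu using hc u hu.le
          simp [this.deriv_eq]
    _ = b * (C * ENNReal.ofReal T) := by
        rw [lintegral_indicator_const measurableSet_Iic, Measure.restrict_apply measurableSet_Iic,
          Set.inter_comm, Set.Ici_inter_Iic, Real.volume_Icc, sub_zero, mul_assoc]

end PathLemmas

/-- An antitone nonnegative integrable function is `o(1 / r)` at infinity. -/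
lemma tendsto_mul_atTop_of_antitone_integrable {J : ℝ → ℝ} (hJ : Antitone J)
    (hJ0 : ∀ r, 0 ≤ J r) (hJi : IntegrableOn J (Set.Ioi 0)) :
    Tendsto (fun r => r * J r) atTop (𝓝 0) := by
  have h1 := intervalIntegral_tendsto_integral_Ioi (0:ℝ) hJi tendsto_id
  have h2 := intervalIntegral_tendsto_integral_Ioi (0:ℝ) hJi
    (tendsto_id.atTop_div_const (two_pos (α := ℝ)))
  have h3 := (h1.sub h2).const_mul 2
  rw [sub_self, mul_zero] at h3
  refine squeeze_zero' ?_ ?_ h3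
  · filter_upwards [eventually_ge_atTop 0] with r hr using mul_nonneg hr (hJ0 r)
  · filter_upwards [eventually_ge_atTop 0] with r hr
    have hJint (a b : ℝ) : IntervalIntegrable J volume a b := hJ.intervalIntegrable
    rw [id, intervalIntegral.integral_interval_sub_left (hJint _ _) (hJint _ _)]
    have h4 : ∫ _ in (r / 2)..r, J r ≤ ∫ s in (r / 2)..r, J s :=
      intervalIntegral.integral_mono_on (by linarith) (by simp) (hJint _ _)
        fun s hs => hJ hs.2
    rw [intervalIntegral.integral_const, smul_eq_mul] at h4
    linarith

/-- Along a single path the mollified hitting indicator converges to the hitting indicator. -/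
lemma tendsto_mollified_indicator {E : Type*} [NormedAddCommGroup E] [NormedSpace ℝ E]
    [FiniteDimensional ℝ E] {J : ℝ → ℝ} (hJc : Continuous J) (hJa : Antitone J)
    (hJ0 : ∀ r, 0 ≤ J r) (hJB : ∀ r, J r ≤ J 0) (hJi : IntegrableOn J (Set.Ioi 0))
    (hJ1 : 1 ≤ ∫ r in Set.Ioi (0:ℝ), J r) {γ : ℝ → E} (hγ : LipschitzWith 1 γ)
    {T : ℝ} (hT : 0 ≤ T) (hc : ∀ t ≥ T, γ t = γ T) {x : E} (hx : γ 0 ≠ x)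
    [Decidable (∃ t, 0 ≤ t ∧ γ t = x)] :
    Tendsto (fun ε : ℝ => min 1 (∫⁻ t in Set.Ici (0:ℝ),
        ENNReal.ofReal (1 / ε * J (dist (γ t) x / ε)) * ‖deriv γ t‖ₑ)) (𝓝[>] 0)
      (𝓝 (if ∃ t, 0 ≤ t ∧ γ t = x then 1 else 0)) := by
  have hpos : ∀ᶠ ε : ℝ in 𝓝[>] 0, 0 < ε := self_mem_nhdsWithin
  have hdiv {a : ℝ} (ha : 0 < a) : Tendsto (fun ε : ℝ => a / ε) (𝓝[>] 0) atTop := by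
    simpa only [div_eq_mul_inv] using tendsto_inv_nhdsGT_zero.const_mul_atTop ha
  split_ifs with hhit
  · obtain ⟨t₀, ht₀, rfl⟩ := hhit
    have hlim : Tendsto (fun ε : ℝ => min 1 (ENNReal.ofReal
        (∫ r in (0:ℝ)..dist (γ 0) (γ t₀) / ε, J r))) (𝓝[>] 0) (𝓝 1) := by
      have h := (tendsto_const_nhds (x := (1 : ℝ≥0∞))).min (ENNReal.tendsto_ofReal
        (intervalIntegral_tendsto_integral_Ioi (0:ℝ) hJi (hdiv (dist_pos.2 hx))))
      rwa [min_eq_left (ENNReal.one_le_ofReal.2 hJ1)] at h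
    refine tendsto_of_tendsto_of_tendsto_of_le_of_le' hlim tendsto_const_nhds ?_
      (Eventually.of_forall fun ε => min_le_left _ _)
    filter_upwards [hpos] with ε hε
    have hK0 (r : ℝ) : 0 ≤ 1 / ε * J (r / ε) := mul_nonneg (by positivity) (hJ0 _)
    have h := ofReal_integral_le_lintegral_of_path hγ ht₀ (K := fun r => 1 / ε * J (r / ε))
      (B := (1 / ε * J 0).toNNReal) (by fun_prop)
      (fun r => by
        rw [Real.norm_of_nonneg (hK0 r)]
        exact (mul_le_mul_of_nonneg_left (hJB _) (by positivity)).trans (Real.le_coe_toNNReal _))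
      hK0
    rw [intervalIntegral.integral_const_mul, intervalIntegral.integral_comp_div _ hε.ne',
      smul_eq_mul, ← mul_assoc, one_div_mul_cancel hε.ne', one_mul, zero_div] at h
    exact min_le_min le_rfl h
  · push Not at hhit
    obtain ⟨δ, hδ, hle⟩ := exists_pos_le_dist_of_eventually_const hγ.continuous hT hc hhit
    have hlim : Tendsto (fun ε : ℝ => ENNReal.ofReal (1 / ε * J (δ / ε)) *
        (((1 : ℝ≥0) : ℝ≥0∞) * ENNReal.ofReal T)) (𝓝[>] 0) (𝓝 0) := by
      have h1 := ((tendsto_mul_atTop_of_antitone_integrable hJa hJ0 hJi).comp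
        (hdiv hδ)).const_mul (1 / δ)
      have h2 : Tendsto (fun ε : ℝ => 1 / ε * J (δ / ε)) (𝓝[>] 0) (𝓝 0) := by
        rw [mul_zero] at h1
        refine h1.congr fun ε => ?_
        simp only [Function.comp_apply]
        field_simp
      have h3 := ENNReal.Tendsto.mul_const (b := ((1 : ℝ≥0) : ℝ≥0∞) * ENNReal.ofReal T)
        (ENNReal.tendsto_ofReal h2) (Or.inr (by finiteness))
      simpa using h3
    refine tendsto_of_tendsto_of_tendsto_of_le_of_le' tendsto_const_nhds hlim
      (Eventually.of_forall fun ε => zero_le) ?_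
    filter_upwards [hpos] with ε hε
    refine (min_le_right _ _).trans (lintegral_mul_enorm_deriv_le hγ hc fun t ht => ?_)
    have := hJa (div_le_div_of_nonneg_right (hle t ht) hε.le)
    gcongr

/-- the alternative mollified multiplicity converges to the
multiplicity as `ε → 0+`. -/
theorem alt_mollified_mult_tendsto_mult {d : ℕ} (hd : 1 ≤ d)
    (μ : Measure (Euc d)) [IsFiniteMeasure μ]
    (hsupp : ∃ R : ℝ, μ (Metric.closedBall 0 R)ᶜ = 0)
    (J : ℝ → ℝ) (hJ : MollKernel2 J)
    (χ : ℝ → ℝ → Euc d) (hχ : IsIrrigPlan μ χ) (x : Euc d) (hx : x ≠ 0) :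
    Tendsto (fun ε : ℝ => Wtil μ J ε χ x) (𝓝[>] (0:ℝ)) (𝓝 (mult μ χ x)) := by
  classical
  obtain ⟨hsm, hJpos, hanti, hJint, hone⟩ := hJ
  let K : ℝ → ℝ := fun r => J (max r 0)
  have hKJ {r : ℝ} (hr : 0 ≤ r) : K r = J r := by simp only [K, max_eq_left hr]
  have hKc : Continuous K :=
    hsm.continuousOn.comp_continuous (by fun_prop) fun r => le_max_right r 0
  have hKa : Antitone K := fun a b hab =>
    hanti.antitoneOn (le_max_right a 0) (le_max_right b 0) (max_le_max hab le_rfl)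
  have hK0 (r : ℝ) : 0 ≤ K r := (hJpos _ (le_max_right r 0)).le
  have hKB (r : ℝ) : K r ≤ K 0 :=
    hanti.antitoneOn (Set.mem_Ici.2 (le_max_right 0 0))
      (Set.mem_Ici.2 (le_max_right r 0)) (by simp)
  have hKi : IntegrableOn K (Set.Ioi 0) :=
    hJint.congr_fun (fun r hr => (hKJ (le_of_lt hr)).symm) measurableSet_Ioi
  have hK1 : 1 ≤ ∫ r in Set.Ioi (0:ℝ), K r := by
    rwa [setIntegral_congr_fun measurableSet_Ioi fun r hr => hKJ (le_of_lt hr)]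
  let F : ℝ → ℝ → ℝ≥0∞ := fun ε θ => min 1 (∫⁻ t in Set.Ici (0:ℝ),
    ENNReal.ofReal (1 / ε * K (dist (χ θ t) x / ε)) * ‖deriv (χ θ) t‖ₑ)
  have hW : (fun ε => ∫⁻ θ in Theta μ, F ε θ) =ᶠ[𝓝[>] 0] fun ε => Wtil μ J ε χ x := by
    filter_upwards [self_mem_nhdsWithin] with ε hε
    have hε' : 0 < ε := hε
    have (θ t : ℝ) : K (dist (χ θ t) x / ε) = J (dist (χ θ t) x / ε) := hKJ (by positivity)
    simp only [F, Wtil, this, enorm_eq_nnnorm]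
  have hΘ : MeasurableSet (Theta μ) := measurableSet_Icc
  have hF (ε : ℝ) : AEMeasurable (F ε) (volume.restrict (Theta μ)) :=
    aemeasurable_const.min (aemeasurable_lintegral_mul_enorm_deriv hΘ hχ.measurable hχ.lipschitz
      (w := fun y => ENNReal.ofReal (1 / ε * K (dist y x / ε))) (by fun_prop))
  let A : Set ℝ := {θ | ∃ t, 0 ≤ t ∧ χ θ t = x}
  have hlim : ∀ᵐ θ ∂volume.restrict (Theta μ),
      Tendsto (fun ε => F ε θ) (𝓝[>] 0) (𝓝 (A.indicator (fun _ => 1) θ)) := by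
    filter_upwards [ae_restrict_mem hΘ] with θ hθ
    obtain ⟨T, hT, hc⟩ := hχ.eventuallyConst θ hθ
    rw [Set.indicator_apply]
    exact tendsto_mollified_indicator hKc hKa hK0 hKB hKi hK1 (hχ.lipschitz θ hθ) hT.le hc
      (by rw [hχ.init θ hθ]; exact hx.symm)
  have hA : NullMeasurableSet A (volume.restrict (Theta μ)) :=
    (aemeasurable_indicator_const_iff (1 : ℝ≥0∞)).1
      (aemeasurable_of_tendsto_metrizable_ae (𝓝[>] 0) hF hlim)
  have hmult : mult μ χ x = ∫⁻ θ in Theta μ, A.indicator (fun _ => 1) θ := by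
    rw [lintegral_indicator_const₀ hA, one_mul, Measure.restrict_apply₀ hA, Set.inter_comm]
    rfl
  rw [hmult]
  refine Tendsto.congr' hW (tendsto_lintegral_filter_of_dominated_convergence' (fun _ => 1)
    (Eventually.of_forall hF)
    (Eventually.of_forall fun ε => Eventually.of_forall fun θ => min_le_left _ _) ?_ hlim)
  simp [Theta]

end
end

section
/- Let χ ∈ IP(μ) be an admissible irrigation plan and α ∈ [0,1]. Then the alternative mollified irrigation costs converge to the irrigation cost as the mollification parameter tends to zero: lim_{ε→0+} Ẽ^α_ε(χ) = E^α(χ). -/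
open MeasureTheory Filter Topology
open scoped ENNReal NNReal

noncomputable section

section Paths

variable {d : ℕ}

lemma norm_deriv_dist_le {γ : ℝ → Euc d} {x : Euc d} {t : ℝ}
    (h1 : DifferentiableAt ℝ γ t) (h2 : DifferentiableAt ℝ (fun s => dist (γ s) x) t) :
    ‖deriv (fun s => dist (γ s) x) t‖ ≤ ‖deriv γ t‖ := by
  have e1 := (hasDerivAt_iff_tendsto_slope.1 h1.hasDerivAt).norm
  have e2 := (hasDerivAt_iff_tendsto_slope.1 h2.hasDerivAt).norm
  refine le_of_tendsto_of_tendsto' e2 e1 fun s => ?_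
  rw [slope_def_module, slope_def_module, norm_smul, norm_smul]
  gcongr
  rw [Real.norm_eq_abs, ← dist_eq_norm]
  exact abs_dist_sub_le _ _ _

/-- A Lipschitz path has zero velocity at almost every time it spends at the origin. -/
lemma ae_deriv_eq_zero_of_eq_zero {γ : ℝ → Euc d} (hγ : LipschitzWith 1 γ) :
    ∀ᵐ t, γ t = 0 → deriv γ t = 0 := by
  have hn : LipschitzWith 1 (fun s => ‖γ s‖) := by
    have := lipschitzWith_one_norm.comp hγ
    rwa [one_mul] at this
  filter_upwards [hn.ae_differentiableAt_real] with t ht h0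
  have hmin : IsLocalMin (fun s => ‖γ s‖) t := by
    refine Filter.Eventually.of_forall fun s => ?_
    simp [h0]
  have hd : HasDerivAt (fun s => ‖γ s‖) 0 t := hmin.deriv_eq_zero ▸ ht.hasDerivAt
  refine HasDerivAt.deriv ?_
  rw [hasDerivAt_iff_isLittleO] at hd ⊢
  simpa [h0, Asymptotics.isLittleO_norm_left] using hd

/-- The line integral of a radial weight along a path dominates its radial integral between the
distances of two points of the path. -/
lemma ofReal_integral_le_lintegral_radial {γ : ℝ → Euc d} (hγ : LipschitzWith 1 γ) (x : Euc d)
    {φ : ℝ → ℝ} (hφ : Continuous φ) (hφ0 : ∀ r, 0 ≤ φ r) {C : ℝ≥0} (hC : ∀ r, φ r ≤ C)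
    {a b : ℝ} (ha : 0 ≤ a) (hb : 0 ≤ b) :
    ENNReal.ofReal (∫ r in dist (γ b) x..dist (γ a) x, φ r) ≤
      ∫⁻ t in Set.Ici (0 : ℝ), ENNReal.ofReal (φ (dist (γ t) x)) * ‖deriv γ t‖ₑ := by
  set r : ℝ → ℝ := fun t => dist (γ t) x with hr
  set K : ℝ → ℝ := fun u => ∫ v in (0 : ℝ)..u, φ v with hK
  have hKd : ∀ u, HasDerivAt K (φ u) u := fun u => hφ.integral_hasStrictDerivAt 0 u |>.hasDerivAt
  have hrL : LipschitzWith 1 r := by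
    have := (LipschitzWith.dist_left x).comp hγ
    rwa [one_mul] at this
  have hKL : LipschitzWith C K :=
    lipschitzWith_of_nnnorm_deriv_le (fun u => (hKd u).differentiableAt) fun u => by
      rw [(hKd u).deriv, ← NNReal.coe_le_coe, coe_nnnorm, Real.norm_of_nonneg (hφ0 u)]
      exact hC u
  have hF : LipschitzWith (C * 1) (K ∘ r) := hKL.comp hrL
  have hAC : AbsolutelyContinuousOnInterval (K ∘ r) b a :=
    (hF.lipschitzOnWith (s := Set.uIcc b a)).absolutelyContinuousOnInterval
  have hsub : ∫ v in r b..r a, φ v = ∫ t in b..a, deriv (K ∘ r) t := by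
    rw [hAC.integral_deriv_eq_sub]
    exact (intervalIntegral.integral_interval_sub_left (hφ.intervalIntegrable _ _)
      (hφ.intervalIntegrable _ _)).symm
  have hle : ∀ᵐ t, ‖deriv (K ∘ r) t‖ₑ ≤ ENNReal.ofReal (φ (r t)) * ‖deriv γ t‖ₑ := by
    filter_upwards [hγ.ae_differentiableAt_real, hrL.ae_differentiableAt_real] with t h1 h2
    rw [((hKd (r t)).comp t h2.hasDerivAt).deriv, enorm_mul,
      Real.enorm_of_nonneg (hφ0 _)]
    gcongr
    exact enorm_le_iff_norm_le.2 (norm_deriv_dist_le h1 h2)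
  calc ENNReal.ofReal (∫ v in r b..r a, φ v)
      ≤ ‖∫ t in b..a, deriv (K ∘ r) t‖ₑ := by
        rw [hsub]; exact Real.ofReal_le_enorm _
    _ = ‖∫ t in Set.uIoc b a, deriv (K ∘ r) t‖ₑ := by
        rw [← ofReal_norm, ← ofReal_norm, intervalIntegral.norm_intervalIntegral_eq]
    _ ≤ ∫⁻ t in Set.uIoc b a, ‖deriv (K ∘ r) t‖ₑ := enorm_integral_le_lintegral_enorm _
    _ ≤ ∫⁻ t in Set.uIoc b a, ENNReal.ofReal (φ (r t)) * ‖deriv γ t‖ₑ :=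
        lintegral_mono_ae (ae_restrict_of_ae hle)
    _ ≤ _ := lintegral_mono_set <|
        Set.Ioc_subset_Ioi_self.trans <| Set.Ioi_subset_Ici (le_min hb ha)

/-- An eventually constant Lipschitz path has finite length. -/
lemma lintegral_enorm_deriv_lt_top {γ : ℝ → Euc d} (hγ : LipschitzWith 1 γ)
    (hc : ∃ t, 0 < t ∧ ∀ t' ≥ t, γ t' = γ t) :
    ∫⁻ t in Set.Ici (0 : ℝ), ‖deriv γ t‖ₑ < ∞ := by
  obtain ⟨T, hT, h⟩ := hc
  calc ∫⁻ t in Set.Ici (0 : ℝ), ‖deriv γ t‖ₑ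
      ≤ ∫⁻ t in Set.Ici (0 : ℝ), (Set.Icc 0 T).indicator 1 t := by
        refine setLIntegral_mono' measurableSet_Ici fun t ht => ?_
        by_cases htT : t ≤ T
        · rw [Set.indicator_of_mem (Set.mem_Icc.2 ⟨ht, htT⟩), Pi.one_apply]
          have := norm_deriv_le_of_lipschitz (x₀ := t) hγ
          rw [← enorm_one (G := ℝ)]
          exact enorm_le_iff_norm_le.2 (by simpa using this)
        · push Not at htT
          have : γ =ᶠ[𝓝 t] fun _ => γ T := by
            filter_upwards [Ioi_mem_nhds htT] with s hs using h s (le_of_lt hs)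
          simp [this.deriv_eq]
    _ ≤ ∫⁻ t, (Set.Icc 0 T).indicator 1 t := setLIntegral_le_lintegral _ _
    _ = volume (Set.Icc 0 T) := lintegral_indicator_one measurableSet_Icc
    _ < ∞ := by simp

/-- The set of points visited by an eventually constant path is closed. -/
lemma isClosed_path_image {γ : ℝ → Euc d} (hγ : LipschitzWith 1 γ)
    (hc : ∃ t, 0 < t ∧ ∀ t' ≥ t, γ t' = γ t) : IsClosed (γ '' Set.Ici 0) := by
  obtain ⟨T, hT, h⟩ := hc
  have : γ '' Set.Ici 0 = γ '' Set.Icc 0 T := by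
    apply subset_antisymm
    · rintro _ ⟨t, ht, rfl⟩
      by_cases htT : t ≤ T
      · exact ⟨t, ⟨ht, htT⟩, rfl⟩
      · exact ⟨T, ⟨hT.le, le_rfl⟩, (h t (not_le.1 htT).le).symm⟩
    · exact Set.image_mono fun t ht => ht.1
  rw [this]
  exact (isCompact_Icc.image hγ.continuous).isClosed

end Paths

section Kernel

/-- A continuous, positive, antitone kernel that is bounded by its value at `0` and whose integral
over the half-line is finite and at least `1`. -/
structure RadialKernel (J : ℝ → ℝ) : Prop where
  continuous : Continuous J
  antitone : Antitone J
  pos : ∀ r, 0 < J r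
  le_zero : ∀ r, J r ≤ J 0
  integrableOn : IntegrableOn J (Set.Ioi 0)
  one_le_integral : 1 ≤ ∫ r in Set.Ioi (0 : ℝ), J r

/-- Freezing an alternative mollifying kernel at its value at `0` on the negative half-line. -/
lemma MollKernel2.radialKernel {J : ℝ → ℝ} (hJ : MollKernel2 J) :
    RadialKernel (fun r => J (max r 0)) := by
  obtain ⟨hs, hp, ha, hi, h1⟩ := hJ
  have heq : Set.EqOn (fun r => J (max r 0)) J (Set.Ioi 0) := fun r hr => by
    simp [max_eq_left (le_of_lt (Set.mem_Ioi.1 hr))]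
  refine ⟨?_, ?_, fun r => hp _ (le_max_right _ _), fun r => ?_, ?_, ?_⟩
  · exact hs.continuousOn.comp_continuous (by fun_prop) fun r => le_max_right r 0
  · exact fun r s hrs => ha.antitoneOn (Set.mem_Ici.2 (le_max_right _ _))
      (Set.mem_Ici.2 (le_max_right _ _))
      (max_le_max_right 0 hrs)
  · simp only [max_self]
    exact ha.antitoneOn (Set.mem_Ici.2 le_rfl) (Set.mem_Ici.2 (le_max_right _ _)) (le_max_right _ _)
  · exact hi.congr_fun heq.symm measurableSet_Ioi
  · rwa [setIntegral_congr_fun measurableSet_Ioi heq]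

variable {J : ℝ → ℝ}

lemma RadialKernel.tendsto_integral (hJ : RadialKernel J) :
    Tendsto (fun R : ℝ => ∫ r in (0 : ℝ)..R, J r) atTop (𝓝 (∫ r in Set.Ioi (0 : ℝ), J r)) :=
  intervalIntegral_tendsto_integral_Ioi 0 hJ.integrableOn tendsto_id

lemma RadialKernel.mul_le_integral (hJ : RadialKernel J) {a b : ℝ} (hab : a ≤ b) :
    (b - a) * J b ≤ ∫ r in a..b, J r := by
  have := intervalIntegral.integral_mono_on hab (intervalIntegrable_const (μ := volume) (c := J b))
    (hJ.continuous.intervalIntegrable _ _) fun r hr => hJ.antitone hr.2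
  simpa using this

lemma RadialKernel.tendsto_mul_atTop (hJ : RadialKernel J) :
    Tendsto (fun r => r * J r) atTop (𝓝 0) := by
  have h2 : Tendsto (fun R : ℝ => R / 2) atTop atTop := tendsto_id.atTop_div_const (by norm_num)
  have h : Tendsto (fun R : ℝ => 2 * ((∫ r in (0 : ℝ)..R, J r) - ∫ r in (0 : ℝ)..(R / 2), J r))
      atTop (𝓝 0) := by
    simpa using (hJ.tendsto_integral.sub (hJ.tendsto_integral.comp h2)).const_mul 2
  refine tendsto_of_tendsto_of_tendsto_of_le_of_le' tendsto_const_nhds h ?_ ?_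
  · filter_upwards [eventually_ge_atTop 0] with R hR using mul_nonneg hR (hJ.pos R).le
  · filter_upwards [eventually_ge_atTop 0] with R hR
    rw [intervalIntegral.integral_interval_sub_left (hJ.continuous.intervalIntegrable _ _)
      (hJ.continuous.intervalIntegrable _ _)]
    have := hJ.mul_le_integral (a := R / 2) (b := R) (by linarith)
    linarith

lemma tendsto_const_div_nhdsGT_zero {c : ℝ} (hc : 0 < c) :
    Tendsto (fun ε : ℝ => c / ε) (𝓝[>] 0) atTop := by
  simpa [div_eq_mul_inv] using tendsto_inv_nhdsGT_zero.const_mul_atTop hc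

variable {d : ℕ}

/-- The mollified amount by which the path `γ` visits the point `x`. -/
def pathWeight (J : ℝ → ℝ) (ε : ℝ) (γ : ℝ → Euc d) (x : Euc d) : ℝ≥0∞ :=
  ∫⁻ t in Set.Ici (0 : ℝ), ENNReal.ofReal ((1 / ε) * J (dist (γ t) x / ε)) * ‖deriv γ t‖ₑ

lemma Wtil_eq_lintegral_pathWeight (μ : Measure (Euc d)) (J : ℝ → ℝ) (ε : ℝ)
    (χ : ℝ → ℝ → Euc d) (x : Euc d) :
    Wtil μ J ε χ x = ∫⁻ θ in Theta μ, min 1 (pathWeight J ε (χ θ) x) := rfl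

variable {γ : ℝ → Euc d} {x : Euc d} {ε : ℝ}

lemma ofReal_integral_le_pathWeight (hJ : RadialKernel J) (hγ : LipschitzWith 1 γ)
    (h0 : γ 0 = 0) (hε : 0 < ε) {t : ℝ} (ht : 0 ≤ t) (hx : γ t = x) :
    ENNReal.ofReal (∫ r in (0 : ℝ)..‖x‖ / ε, J r) ≤ pathWeight J ε γ x := by
  have hcont : Continuous fun r => (1 / ε) * J (r / ε) := by
    have := hJ.continuous
    fun_prop
  have hb : 0 ≤ (1 / ε) * J 0 := mul_nonneg (by positivity) (hJ.pos 0).le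
  have key := ofReal_integral_le_lintegral_radial hγ x (φ := fun r => (1 / ε) * J (r / ε)) hcont
    (fun r => mul_nonneg (by positivity) (hJ.pos _).le) (C := ⟨(1 / ε) * J 0, hb⟩)
    (fun r => mul_le_mul_of_nonneg_left (hJ.le_zero _) (by positivity)) le_rfl ht
  rw [hx, dist_self, h0, dist_zero_left, intervalIntegral.integral_const_mul, one_div,
    intervalIntegral.inv_mul_integral_comp_div, zero_div] at key
  simpa [pathWeight] using key

lemma ofReal_two_le_pathWeight_of_visit (hJ : RadialKernel J) (hγ : LipschitzWith 1 γ)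
    (h0 : γ 0 = 0) (hε : 0 < ε) {t : ℝ} (ht : 0 ≤ t) (hx : γ t = x) (hxε : ε ≤ ‖x‖) :
    ENNReal.ofReal (J 2) ≤ pathWeight J ε γ x := by
  refine le_trans (ENNReal.ofReal_le_ofReal ?_) (ofReal_integral_le_pathWeight hJ hγ h0 hε ht hx)
  have h1 : 1 ≤ ‖x‖ / ε := (one_le_div hε).2 hxε
  calc J 2 ≤ J 1 := hJ.antitone (by norm_num)
    _ ≤ ∫ r in (0 : ℝ)..1, J r := by simpa using hJ.mul_le_integral (a := 0) (b := 1) zero_le_one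
    _ ≤ _ := intervalIntegral.integral_mono_interval le_rfl zero_le_one h1
        (Eventually.of_forall fun r => (hJ.pos r).le) (hJ.continuous.intervalIntegrable _ _)

lemma ofReal_two_le_pathWeight_of_exit (hJ : RadialKernel J) (hγ : LipschitzWith 1 γ)
    (h0 : γ 0 = 0) (hε : 0 < ε) {t : ℝ} (ht : 0 ≤ t) (hxε : ‖x‖ ≤ ε) (hexit : ε ≤ ‖γ t‖) :
    ENNReal.ofReal (J 2) ≤ pathWeight J ε γ x := by
  have hcont : Continuous fun r => (1 / ε) * J (r / ε + 1) := by
    have := hJ.continuous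
    fun_prop
  have hb : 0 ≤ (1 / ε) * J 0 := mul_nonneg (by positivity) (hJ.pos 0).le
  have key := ofReal_integral_le_lintegral_radial hγ 0 (φ := fun r => (1 / ε) * J (r / ε + 1)) hcont
    (fun r => mul_nonneg (by positivity) (hJ.pos _).le) (C := ⟨(1 / ε) * J 0, hb⟩)
    (fun r => mul_le_mul_of_nonneg_left (hJ.le_zero _) (by positivity)) ht le_rfl
  rw [h0, dist_self, dist_zero_right] at key
  have hlow : J 2 ≤ ∫ r in (0 : ℝ)..‖γ t‖, (1 / ε) * J (r / ε + 1) := by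
    calc J 2 = ∫ _ in (0 : ℝ)..ε, (1 / ε) * J 2 := by
          rw [intervalIntegral.integral_const, smul_eq_mul]; field_simp; ring
      _ ≤ ∫ r in (0 : ℝ)..ε, (1 / ε) * J (r / ε + 1) := by
          refine intervalIntegral.integral_mono_on hε.le (by simp)
            (hcont.intervalIntegrable _ _) fun r hr => ?_
          refine mul_le_mul_of_nonneg_left (hJ.antitone ?_) (by positivity)
          have := (div_le_one hε).2 hr.2
          linarith
      _ ≤ _ := intervalIntegral.integral_mono_interval le_rfl hε.le hexit
          (Eventually.of_forall fun r => mul_nonneg (by positivity) (hJ.pos _).le)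
          (hcont.intervalIntegrable _ _)
  refine (ENNReal.ofReal_le_ofReal hlow).trans (key.trans ?_)
  refine lintegral_mono fun s => ?_
  dsimp only
  gcongr
  refine hJ.antitone ?_
  rw [div_le_iff₀ hε, add_mul, div_mul_cancel₀ _ hε.ne', one_mul]
  calc dist (γ s) x ≤ dist (γ s) 0 + dist 0 x := dist_triangle _ _ _
    _ ≤ dist (γ s) 0 + ε := by rw [dist_zero_left]; gcongr

lemma tendsto_min_pathWeight_of_visit (hJ : RadialKernel J) (hγ : LipschitzWith 1 γ)
    (h0 : γ 0 = 0) {t : ℝ} (ht : 0 ≤ t) (hx : γ t = x) (hx0 : x ≠ 0) :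
    Tendsto (fun ε => min 1 (pathWeight J ε γ x)) (𝓝[>] 0) (𝓝 1) := by
  have hlim : Tendsto (fun ε => min 1 (ENNReal.ofReal (∫ r in (0 : ℝ)..‖x‖ / ε, J r))) (𝓝[>] 0)
      (𝓝 1) := by
    have h := tendsto_const_nhds (x := (1 : ℝ≥0∞)).min (ENNReal.tendsto_ofReal
      (hJ.tendsto_integral.comp (tendsto_const_div_nhdsGT_zero (norm_pos_iff.2 hx0))))
    rwa [min_eq_left (ENNReal.one_le_ofReal.2 hJ.one_le_integral)] at h
  refine tendsto_of_tendsto_of_tendsto_of_le_of_le' hlim tendsto_const_nhds ?_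
    (Eventually.of_forall fun _ => min_le_left _ _)
  filter_upwards [self_mem_nhdsWithin] with ε hε
  exact min_le_min_left _ (ofReal_integral_le_pathWeight hJ hγ h0 hε ht hx)

lemma tendsto_min_pathWeight_of_not_visit (hJ : RadialKernel J) (hγ : LipschitzWith 1 γ)
    (hc : ∃ t, 0 < t ∧ ∀ t' ≥ t, γ t' = γ t) (hx : ¬ ∃ t, 0 ≤ t ∧ γ t = x) :
    Tendsto (fun ε => min 1 (pathWeight J ε γ x)) (𝓝[>] 0) (𝓝 0) := by
  obtain ⟨δ, hδ, hball⟩ := Metric.isOpen_iff.1 (isClosed_path_image hγ hc).isOpen_compl x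
    (by rintro ⟨t, ht, h⟩; exact hx ⟨t, ht, h⟩)
  have hdist : ∀ t, 0 ≤ t → δ ≤ dist (γ t) x := fun t ht => by
    by_contra! h
    exact hball h ⟨t, ht, rfl⟩
  have hlim : Tendsto (fun ε => ENNReal.ofReal ((1 / δ) * (δ / ε * J (δ / ε))) *
      ∫⁻ t in Set.Ici (0 : ℝ), ‖deriv γ t‖ₑ) (𝓝[>] 0) (𝓝 0) := by
    have h := ENNReal.Tendsto.mul_const (b := ∫⁻ t in Set.Ici (0 : ℝ), ‖deriv γ t‖ₑ)
      (ENNReal.tendsto_ofReal ((hJ.tendsto_mul_atTop.comp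
        (tendsto_const_div_nhdsGT_zero hδ)).const_mul (1 / δ)))
      (Or.inr (lintegral_enorm_deriv_lt_top hγ hc).ne)
    simpa using h
  refine tendsto_of_tendsto_of_tendsto_of_le_of_le' tendsto_const_nhds hlim
    (Eventually.of_forall fun _ => zero_le) ?_
  filter_upwards [self_mem_nhdsWithin] with ε hε
  have hε : 0 < ε := hε
  refine (min_le_right _ _).trans ?_
  rw [← lintegral_const_mul' _ _ ENNReal.ofReal_ne_top]
  refine setLIntegral_mono' measurableSet_Ici fun t ht => ?_
  gcongr ENNReal.ofReal ?_ * _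
  have : (1 / δ) * (δ / ε * J (δ / ε)) = (1 / ε) * J (δ / ε) := by field_simp
  rw [this]
  gcongr
  exact hJ.antitone (by gcongr; exact hdist t ht)

end Kernel

section Plans

variable {d : ℕ} {μ : Measure (Euc d)} {χ : ℝ → ℝ → Euc d} {J : ℝ → ℝ}

/-- An everywhere defined, jointly measurable substitute for the speed of the paths of a plan. -/
def upperSpeed (χ : ℝ → ℝ → Euc d) (z : ℝ × ℝ) : ℝ≥0∞ :=
  limsup (fun n : ℕ => ‖((n : ℝ) + 1) • (χ z.1 (z.2 + 1 / ((n : ℝ) + 1)) - χ z.1 z.2)‖ₑ) atTop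

lemma measurable_upperSpeed (hχ : Measurable (Function.uncurry χ)) :
    Measurable (upperSpeed χ) := by
  unfold upperSpeed
  refine Measurable.limsup fun n => ?_
  have h1 : Measurable fun z : ℝ × ℝ => χ z.1 (z.2 + 1 / ((n : ℝ) + 1)) :=
    hχ.comp (measurable_fst.prodMk (measurable_snd.add_const (1 / ((n : ℝ) + 1))))
  have h2 : Measurable fun z : ℝ × ℝ => χ z.1 z.2 := hχ
  exact ((h1.sub h2).const_smul ((n : ℝ) + 1)).enorm

lemma upperSpeed_eq {θ t : ℝ} (h : DifferentiableAt ℝ (χ θ) t) :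
    upperSpeed χ (θ, t) = ‖deriv (χ θ) t‖ₑ := by
  have hn : Tendsto (fun n : ℕ => 1 / ((n : ℝ) + 1)) atTop (𝓝[>] 0) :=
    tendsto_nhdsWithin_iff.2 ⟨tendsto_one_div_add_atTop_nhds_zero_nat,
      Eventually.of_forall fun n => by simp only [Set.mem_Ioi]; positivity⟩
  have hs := (h.hasDerivAt.tendsto_slope_zero_right.comp hn).enorm
  simp only [Function.comp_def, one_div, inv_inv] at hs
  simpa [upperSpeed] using hs.limsup_eq

lemma IsIrrigPlan.ae_upperSpeed_eq (hχ : IsIrrigPlan μ χ) {θ : ℝ} (hθ : θ ∈ Theta μ) :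
    ∀ᵐ t, upperSpeed χ (θ, t) = ‖deriv (χ θ) t‖ₑ := by
  filter_upwards [(hχ.lipschitz θ hθ).ae_differentiableAt_real] with t ht using upperSpeed_eq ht

lemma measurableSet_Theta : MeasurableSet (Theta μ) := measurableSet_Icc

lemma IsIrrigPlan.measurableSet_visit (hχ : IsIrrigPlan μ χ) :
    MeasurableSet {p : ℝ × Euc d | p.1 ∈ Theta μ ∧ ∃ t, 0 ≤ t ∧ χ p.1 t = p.2} := by
  have heq : {p : ℝ × Euc d | p.1 ∈ Theta μ ∧ ∃ t, 0 ≤ t ∧ χ p.1 t = p.2} =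
      {p | p.1 ∈ Theta μ} ∩ ⋂ n : ℕ, ⋃ q : ℚ≥0,
        {p | dist (χ p.1 ((q : ℝ))) p.2 < 1 / ((n : ℝ) + 1)} := by
    ext ⟨θ, x⟩
    simp only [Set.mem_ofPred_eq, Set.mem_inter_iff, Set.mem_iInter, Set.mem_iUnion]
    refine and_congr_right fun hθ => ⟨?_, fun h => ?_⟩
    · rintro ⟨t, ht, rfl⟩ n
      obtain ⟨q, hq, hq'⟩ := exists_rat_btwn
        (show t < t + 1 / ((n : ℝ) + 1) by linarith [Nat.one_div_pos_of_nat (α := ℝ) (n := n)])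
      have hq0 : (0 : ℚ) ≤ q := by exact_mod_cast ht.trans hq.le
      lift q to ℚ≥0 using hq0
      refine ⟨q, ((hχ.lipschitz θ hθ).dist_le_mul _ _).trans_lt ?_⟩
      simp only [Rat.cast_nnratCast] at hq hq'
      rw [Real.dist_eq, abs_of_pos (by linarith)]
      simp only [NNReal.coe_one, one_mul]
      linarith
    · have hcl := isClosed_path_image (hχ.lipschitz θ hθ) (hχ.eventuallyConst θ hθ)
      have : x ∈ closure (χ θ '' Set.Ici 0) := by
        rw [Metric.mem_closure_iff]
        intro ε hε
        obtain ⟨n, hn⟩ := exists_nat_one_div_lt hε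
        obtain ⟨q, hq⟩ := h n
        exact ⟨_, ⟨q, Set.mem_Ici.2 (by positivity), rfl⟩, by rw [dist_comm]; exact hq.trans hn⟩
      obtain ⟨t, ht, h⟩ := hcl.closure_eq ▸ this
      exact ⟨t, ht, h⟩
  rw [heq]
  refine (measurable_fst measurableSet_Theta).inter
    (MeasurableSet.iInter fun n => MeasurableSet.iUnion fun q => ?_)
  have h1 : Measurable fun p : ℝ × Euc d => χ p.1 (q : ℝ) :=
    hχ.measurable.comp (measurable_fst.prodMk measurable_const)
  exact measurableSet_lt (h1.dist measurable_snd) measurable_const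

lemma IsIrrigPlan.measurable_mult (hχ : IsIrrigPlan μ χ) : Measurable (mult μ χ) :=
  measurable_measure_prodMk_right hχ.measurableSet_visit

lemma IsIrrigPlan.measurableSet_visit_section (hχ : IsIrrigPlan μ χ) (x : Euc d) :
    MeasurableSet {θ | θ ∈ Theta μ ∧ ∃ t, 0 ≤ t ∧ χ θ t = x} :=
  measurable_prodMk_right hχ.measurableSet_visit

lemma IsIrrigPlan.mult_eq_lintegral (hχ : IsIrrigPlan μ χ) (x : Euc d) :
    mult μ χ x = ∫⁻ θ in Theta μ,
      {θ | θ ∈ Theta μ ∧ ∃ t, 0 ≤ t ∧ χ θ t = x}.indicator 1 θ := by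
  rw [lintegral_indicator_one (hχ.measurableSet_visit_section x),
    Measure.restrict_apply (hχ.measurableSet_visit_section x)]
  exact congrArg volume (Set.inter_eq_left.2 fun θ hθ => hθ.1).symm

lemma volume_Theta_lt_top : volume (Theta μ) < ∞ := measure_Icc_lt_top

lemma mult_le_volume_Theta (x : Euc d) : mult μ χ x ≤ volume (Theta μ) :=
  measure_mono fun _ hθ => hθ.1

lemma IsIrrigPlan.measurable_pathWeight (hχ : IsIrrigPlan μ χ) (hJ : RadialKernel J) (ε : ℝ) :
    Measurable fun p : ℝ × Euc d => ∫⁻ t in Set.Ici (0 : ℝ),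
      ENNReal.ofReal ((1 / ε) * J (dist (χ p.1 t) p.2 / ε)) * upperSpeed χ (p.1, t) := by
  refine Measurable.lintegral_prod_right' (f := fun q : (ℝ × Euc d) × ℝ =>
    ENNReal.ofReal ((1 / ε) * J (dist (χ q.1.1 q.2) q.1.2 / ε)) * upperSpeed χ (q.1.1, q.2)) ?_
  have h1 : Measurable fun q : (ℝ × Euc d) × ℝ => χ q.1.1 q.2 :=
    hχ.measurable.comp ((measurable_fst.comp measurable_fst).prodMk measurable_snd)
  have h2 := (measurable_upperSpeed hχ.measurable).comp
    ((measurable_fst.comp measurable_fst).prodMk measurable_snd :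
      Measurable fun q : (ℝ × Euc d) × ℝ => (q.1.1, q.2))
  have h3 := hJ.continuous.measurable.comp
    ((h1.dist (measurable_snd.comp measurable_fst)).div_const ε)
  exact (h3.const_mul (1 / ε)).ennreal_ofReal.mul h2

lemma IsIrrigPlan.pathWeight_eq (hχ : IsIrrigPlan μ χ) (ε : ℝ) {θ : ℝ} (hθ : θ ∈ Theta μ)
    (x : Euc d) :
    pathWeight J ε (χ θ) x = ∫⁻ t in Set.Ici (0 : ℝ),
      ENNReal.ofReal ((1 / ε) * J (dist (χ θ t) x / ε)) * upperSpeed χ (θ, t) := by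
  refine lintegral_congr_ae (ae_restrict_of_ae ?_)
  filter_upwards [hχ.ae_upperSpeed_eq hθ] with t ht
  rw [ht]

lemma IsIrrigPlan.aemeasurable_min_pathWeight (hχ : IsIrrigPlan μ χ) (hJ : RadialKernel J)
    (ε : ℝ) (x : Euc d) :
    AEMeasurable (fun θ => min 1 (pathWeight J ε (χ θ) x)) (volume.restrict (Theta μ)) := by
  refine AEMeasurable.congr (Measurable.aemeasurable ((measurable_const (a := (1 : ℝ≥0∞))).min
    ((hχ.measurable_pathWeight hJ ε).comp (measurable_prodMk_right (y := x))))) ?_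
  filter_upwards [ae_restrict_mem measurableSet_Theta] with θ hθ
  rw [hχ.pathWeight_eq ε hθ]
  rfl

lemma IsIrrigPlan.measurable_Wtil (hχ : IsIrrigPlan μ χ) (hJ : RadialKernel J) (ε : ℝ) :
    Measurable (Wtil μ J ε χ) := by
  have heq : Wtil μ J ε χ = fun x => ∫⁻ θ in Theta μ, min 1 (∫⁻ t in Set.Ici (0 : ℝ),
      ENNReal.ofReal ((1 / ε) * J (dist (χ θ t) x / ε)) * upperSpeed χ (θ, t)) := by
    ext x
    rw [Wtil_eq_lintegral_pathWeight]
    refine setLIntegral_congr_fun measurableSet_Theta fun θ hθ => ?_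
    simp only [hχ.pathWeight_eq ε hθ]
  rw [heq]
  exact Measurable.lintegral_prod_left' (f := fun p : ℝ × Euc d =>
    min 1 (∫⁻ t in Set.Ici (0 : ℝ), ENNReal.ofReal ((1 / ε) * J (dist (χ p.1 t) p.2 / ε)) *
      upperSpeed χ (p.1, t))) (measurable_const.min (hχ.measurable_pathWeight hJ ε))

/-- Away from the source, the mollified multiplicity converges to the multiplicity. -/
lemma IsIrrigPlan.tendsto_Wtil (hχ : IsIrrigPlan μ χ) (hJ : RadialKernel J) {x : Euc d}
    (hx : x ≠ 0) : Tendsto (fun ε => Wtil μ J ε χ x) (𝓝[>] 0) (𝓝 (mult μ χ x)) := by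
  simp only [Wtil_eq_lintegral_pathWeight, hχ.mult_eq_lintegral]
  refine tendsto_lintegral_filter_of_dominated_convergence' 1
    (Eventually.of_forall fun ε => hχ.aemeasurable_min_pathWeight hJ ε x)
    (Eventually.of_forall fun ε => Eventually.of_forall fun θ => min_le_left _ _) ?_ ?_
  · simpa using (volume_Theta_lt_top (μ := μ)).ne
  · filter_upwards [ae_restrict_mem measurableSet_Theta] with θ hθ
    by_cases h : ∃ t, 0 ≤ t ∧ χ θ t = x
    · obtain ⟨t, ht, htx⟩ := h
      rw [Set.indicator_of_mem (show θ ∈ {θ | θ ∈ Theta μ ∧ ∃ t, 0 ≤ t ∧ χ θ t = x} from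
        ⟨hθ, t, ht, htx⟩)]
      exact tendsto_min_pathWeight_of_visit hJ (hχ.lipschitz θ hθ) (hχ.init θ hθ) ht htx hx
    · rw [Set.indicator_of_notMem fun hmem => h hmem.2]
      exact tendsto_min_pathWeight_of_not_visit hJ (hχ.lipschitz θ hθ) (hχ.eventuallyConst θ hθ) h

/-- The particles that leave the closed ball of radius `r` about the source. -/
def exitSet (μ : Measure (Euc d)) (χ : ℝ → ℝ → Euc d) (r : ℝ) : Set ℝ :=
  {θ | θ ∈ Theta μ ∧ ∃ q : ℚ≥0, r < ‖χ θ q‖}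

lemma IsIrrigPlan.measurableSet_exitSet (hχ : IsIrrigPlan μ χ) (r : ℝ) :
    MeasurableSet (exitSet μ χ r) := by
  refine measurableSet_Theta.inter (?_ : MeasurableSet {θ | ∃ q : ℚ≥0, r < ‖χ θ q‖})
  rw [Set.ofPred_exists]
  refine MeasurableSet.iUnion fun q => measurableSet_lt measurable_const ?_
  exact (hχ.measurable.comp (measurable_prodMk_right (y := (q : ℝ)))).norm

lemma mul_le_Wtil {c : ℝ≥0∞} {ε : ℝ} {x : Euc d} {S : Set ℝ} (hS : MeasurableSet S)
    (hSΘ : S ⊆ Theta μ) (h : ∀ θ ∈ S, c ≤ min 1 (pathWeight J ε (χ θ) x)) :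
    c * volume S ≤ Wtil μ J ε χ x := by
  rw [Wtil_eq_lintegral_pathWeight, ← setLIntegral_const]
  exact (setLIntegral_mono' hS h).trans (lintegral_mono_set hSΘ)

/-- If a non-negligible set of particles leaves the source, then at small scales the mollified
multiplicity uniformly dominates the multiplicity. -/
lemma IsIrrigPlan.mul_mult_le_Wtil (hχ : IsIrrigPlan μ χ) (hJ : RadialKernel J) {r : ℝ}
    {ε : ℝ} (hε : 0 < ε) (hεr : ε ≤ r) (x : Euc d) :
    min 1 (ENNReal.ofReal (J 2)) * (volume (exitSet μ χ r) / volume (Theta μ)) * mult μ χ x ≤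
      Wtil μ J ε χ x := by
  rcases le_total ‖x‖ ε with hx | hx
  · calc _ ≤ min 1 (ENNReal.ofReal (J 2)) * (volume (exitSet μ χ r) / volume (Theta μ)) *
          volume (Theta μ) := by gcongr; exact mult_le_volume_Theta x
      _ ≤ min 1 (ENNReal.ofReal (J 2)) * volume (exitSet μ χ r) := by
          rw [mul_assoc]; gcongr; exact ENNReal.mul_le_of_le_div le_rfl
      _ ≤ _ := mul_le_Wtil (hχ.measurableSet_exitSet r) (fun θ h => h.1) fun θ ⟨hθ, q, hq⟩ =>
          min_le_min_left _ (ofReal_two_le_pathWeight_of_exit hJ (hχ.lipschitz θ hθ)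
            (hχ.init θ hθ) hε (by positivity) hx (hεr.trans hq.le))
  · calc _ ≤ min 1 (ENNReal.ofReal (J 2)) * 1 * mult μ χ x := by
          gcongr
          exact (ENNReal.div_le_div_right (measure_mono fun θ h => h.1) _).trans
            ENNReal.div_self_le_one
      _ = min 1 (ENNReal.ofReal (J 2)) * mult μ χ x := by rw [mul_one]
      _ ≤ _ := mul_le_Wtil (hχ.measurableSet_visit_section x) (fun θ h => h.1)
          fun θ ⟨hθ, t, ht, htx⟩ => min_le_min_left _ (ofReal_two_le_pathWeight_of_visit hJ
            (hχ.lipschitz θ hθ) (hχ.init θ hθ) hε ht htx hx)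

/-- The measure `dθ dt` on `Θ × ℝ₊`. -/
def planMeasure (μ : Measure (Euc d)) : Measure (ℝ × ℝ) :=
  (volume.restrict (Theta μ)).prod (volume.restrict (Set.Ici 0))

lemma IsIrrigPlan.lintegral_planMeasure (hχ : IsIrrigPlan μ χ) {W : Euc d → ℝ≥0∞}
    (hW : Measurable W) :
    ∫⁻ θ in Theta μ, ∫⁻ t in Set.Ici (0 : ℝ), W (χ θ t) * (‖deriv (χ θ) t‖₊ : ℝ≥0∞) =
      ∫⁻ z, W (χ z.1 z.2) * upperSpeed χ z ∂planMeasure μ := by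
  rw [planMeasure, lintegral_prod]
  · refine setLIntegral_congr_fun measurableSet_Theta fun θ hθ => ?_
    refine lintegral_congr_ae (ae_restrict_of_ae ?_)
    filter_upwards [hχ.ae_upperSpeed_eq hθ] with t ht
    rw [ht, enorm_eq_nnnorm]
  · exact ((hW.comp hχ.measurable).mul (measurable_upperSpeed hχ.measurable)).aemeasurable

lemma IsIrrigPlan.ae_planMeasure_upperSpeed (hχ : IsIrrigPlan μ χ) :
    ∀ᵐ z ∂planMeasure μ, upperSpeed χ z ≠ ∞ ∧ (χ z.1 z.2 = 0 → upperSpeed χ z = 0) := by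
  have hs := measurable_upperSpeed hχ.measurable
  have h1 : MeasurableSet {z | upperSpeed χ z ≠ ∞} := (hs (measurableSet_singleton ∞)).compl
  have h2 : MeasurableSet {z : ℝ × ℝ | χ z.1 z.2 = 0} :=
    hχ.measurable (measurableSet_singleton 0)
  have h3 : MeasurableSet {z | upperSpeed χ z = 0} := hs (measurableSet_singleton 0)
  rw [planMeasure, Measure.ae_prod_iff_ae_ae
    (p := fun z => upperSpeed χ z ≠ ∞ ∧ (χ z.1 z.2 = 0 → upperSpeed χ z = 0))
    (h1.inter (h2.himp h3))]
  filter_upwards [ae_restrict_mem measurableSet_Theta] with θ hθ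
  refine ae_restrict_of_ae ?_
  filter_upwards [hχ.ae_upperSpeed_eq hθ, ae_deriv_eq_zero_of_eq_zero (hχ.lipschitz θ hθ)]
    with t ht h0
  rw [ht]
  exact ⟨enorm_ne_top, fun h => by simp [h0 h]⟩

/-- If almost no particle leaves the source, then the plan is at rest. -/
lemma IsIrrigPlan.ae_upperSpeed_eq_zero (hχ : IsIrrigPlan μ χ)
    (h : ∀ n : ℕ, volume (exitSet μ χ (1 / ((n : ℝ) + 1))) = 0) :
    ∀ᵐ z ∂planMeasure μ, upperSpeed χ z = 0 := by
  rw [planMeasure, Measure.ae_prod_iff_ae_ae (p := fun z => upperSpeed χ z = 0)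
    (measurable_upperSpeed hχ.measurable (measurableSet_singleton 0))]
  have hn : ∀ᵐ θ ∂volume.restrict (Theta μ), ∀ n : ℕ, θ ∉ exitSet μ χ (1 / ((n : ℝ) + 1)) :=
    ae_all_iff.2 fun n => ae_restrict_of_ae (measure_eq_zero_iff_ae_notMem.1 (h n))
  filter_upwards [ae_restrict_mem measurableSet_Theta, hn] with θ hθ hout
  have hq : ∀ q : ℚ≥0, χ θ q = 0 := fun q => by
    by_contra hne
    obtain ⟨n, hn⟩ := exists_nat_one_div_lt (norm_pos_iff.2 hne)
    exact hout n ⟨hθ, q, hn⟩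
  have hzero : ∀ t, 0 ≤ t → χ θ t = 0 := fun t ht => by
    by_contra hne
    obtain ⟨δ, hδ, hball⟩ := Metric.isOpen_iff.1
      (isOpen_ne.preimage (hχ.lipschitz θ hθ).continuous) t hne
    obtain ⟨q, h1, h2⟩ := exists_rat_btwn (show t < t + δ by linarith)
    have hq0 : (0 : ℚ) ≤ q := by exact_mod_cast ht.trans h1.le
    lift q to ℚ≥0 using hq0
    simp only [Rat.cast_nnratCast] at h1 h2
    refine hball ?_ (hq q)
    rw [Metric.mem_ball, Real.dist_eq, abs_of_pos (by linarith)]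
    linarith
  filter_upwards [ae_restrict_mem measurableSet_Ici, ae_restrict_of_ae (hχ.ae_upperSpeed_eq hθ),
    ae_restrict_of_ae (ae_deriv_eq_zero_of_eq_zero (hχ.lipschitz θ hθ))] with t ht hs h0
  simp [hs, h0 (hzero t ht)]

lemma RadialKernel.tendsto_Etil (hJ : RadialKernel J) {α : ℝ} (hα : α ∈ Set.Icc (0 : ℝ) 1)
    (hχ : IsIrrigPlan μ χ) :
    Tendsto (fun ε : ℝ => Etil μ J α ε χ) (𝓝[>] (0 : ℝ)) (𝓝 (irrCost μ α χ)) := by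
  set F : ℝ → ℝ × ℝ → ℝ≥0∞ :=
    fun ε z => Wtil μ J ε χ (χ z.1 z.2) ^ (α - 1) * upperSpeed χ z with hF
  set f : ℝ × ℝ → ℝ≥0∞ := fun z => mult μ χ (χ z.1 z.2) ^ (α - 1) * upperSpeed χ z with hf
  have hE : ∀ ε, Etil μ J α ε χ = ∫⁻ z, F ε z ∂planMeasure μ := fun ε =>
    hχ.lintegral_planMeasure ((hχ.measurable_Wtil hJ ε).pow_const (α - 1))
  have hI : irrCost μ α χ = ∫⁻ z, f z ∂planMeasure μ :=
    hχ.lintegral_planMeasure (hχ.measurable_mult.pow_const (α - 1))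
  have hFm : ∀ ε, Measurable (F ε) := fun ε =>
    (((hχ.measurable_Wtil hJ ε).pow_const (α - 1)).comp hχ.measurable).mul
      (measurable_upperSpeed hχ.measurable)
  simp_rw [hE, hI]
  have hlim : ∀ᵐ z ∂planMeasure μ, Tendsto (fun ε => F ε z) (𝓝[>] 0) (𝓝 (f z)) := by
    filter_upwards [hχ.ae_planMeasure_upperSpeed] with z ⟨hz, hz0⟩
    by_cases h0 : χ z.1 z.2 = 0
    · simp [hF, hf, hz0 h0]
    · exact ENNReal.Tendsto.mul_const
        ((ENNReal.continuous_rpow_const.tendsto _).comp (hχ.tendsto_Wtil hJ h0)) (Or.inr hz)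
  by_cases hexit : ∀ n : ℕ, volume (exitSet μ χ (1 / ((n : ℝ) + 1))) = 0
  · have hrest := hχ.ae_upperSpeed_eq_zero hexit
    have hF0 : ∀ ε, ∫⁻ z, F ε z ∂planMeasure μ = 0 := fun ε =>
      lintegral_eq_zero_of_ae_eq_zero (by filter_upwards [hrest] with z hz; simp [hF, hz])
    have hf0 : ∫⁻ z, f z ∂planMeasure μ = 0 :=
      lintegral_eq_zero_of_ae_eq_zero (by filter_upwards [hrest] with z hz; simp [hf, hz])
    simp [hF0, hf0]
  push Not at hexit
  obtain ⟨n, hn⟩ := hexit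
  by_cases htop : ∫⁻ z, f z ∂planMeasure μ = ∞
  · rw [htop]
    refine tendsto_of_le_liminf_of_limsup_le ?_ le_top
    rw [← htop]
    calc ∫⁻ z, f z ∂planMeasure μ = ∫⁻ z, liminf (fun ε => F ε z) (𝓝[>] 0) ∂planMeasure μ :=
          lintegral_congr_ae (hlim.mono fun z hz => hz.liminf_eq.symm)
      _ ≤ _ := lintegral_liminf_le hFm
  · set c := min 1 (ENNReal.ofReal (J 2)) *
      (volume (exitSet μ χ (1 / ((n : ℝ) + 1))) / volume (Theta μ)) with hc
    have hΘ := (volume_Theta_lt_top (μ := μ)).ne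
    have hle : volume (exitSet μ χ (1 / ((n : ℝ) + 1))) ≤ volume (Theta μ) :=
      measure_mono fun θ h => h.1
    have hmin : min 1 (ENNReal.ofReal (J 2)) ≠ 0 :=
      (lt_min one_pos (ENNReal.ofReal_pos.2 (hJ.pos 2))).ne'
    have hc0 : c ≠ 0 := mul_ne_zero hmin (ENNReal.div_ne_zero.2 ⟨hn, hΘ⟩)
    have hct : c ≠ ∞ := ENNReal.mul_ne_top (min_le_left _ _ |>.trans_lt ENNReal.one_lt_top).ne
      (ENNReal.div_le_div_right hle _ |>.trans ENNReal.div_self_le_one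
        |>.trans_lt ENNReal.one_lt_top).ne
    have hcα : c ^ (α - 1) ≠ ∞ := by
      simp [ENNReal.rpow_eq_top_iff, hc0, hct]
    refine tendsto_lintegral_filter_of_dominated_convergence (fun z => c ^ (α - 1) * f z)
      (Eventually.of_forall hFm) ?_ ?_ hlim
    · have hpos : (0 : ℝ) < 1 / ((n : ℝ) + 1) := by positivity
      filter_upwards [Ioc_mem_nhdsGT hpos] with ε hε
      refine Eventually.of_forall fun z => ?_
      simp only [hF, hf]
      rw [← mul_assoc, ← ENNReal.mul_rpow_of_ne_top hct
        ((mult_le_volume_Theta _).trans_lt volume_Theta_lt_top).ne]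
      gcongr ?_ * _
      rw [← neg_sub, ENNReal.rpow_neg, ENNReal.rpow_neg, ENNReal.inv_le_inv]
      exact ENNReal.rpow_le_rpow (hχ.mul_mult_le_Wtil hJ hε.1 hε.2 _) (by linarith [hα.2])
    · rw [lintegral_const_mul' _ _ hcα]
      exact ENNReal.mul_ne_top hcα htop

/-- The mollified cost only depends on the kernel on the nonnegative half-line. -/
lemma Etil_congr {J' : ℝ → ℝ} (h : Set.EqOn J J' (Set.Ici 0)) {ε : ℝ} (hε : 0 ≤ ε) (α : ℝ) :
    Etil μ J α ε χ = Etil μ J' α ε χ := by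
  have hW : Wtil μ J ε χ = Wtil μ J' ε χ := by
    ext x
    have : ∀ θ t, J (dist (χ θ t) x / ε) = J' (dist (χ θ t) x / ε) :=
      fun θ t => h (Set.mem_Ici.2 (by positivity))
    simp only [Wtil, this]
  simp only [Etil, hW]

end Plans

/-- the alternative mollified irrigation costs converge to the
irrigation cost as `ε → 0+`. -/
theorem alt_mollified_cost_tendsto_cost {d : ℕ} (hd : 1 ≤ d)
    (μ : Measure (Euc d)) [IsFiniteMeasure μ]
    (hsupp : ∃ R : ℝ, μ (Metric.closedBall 0 R)ᶜ = 0)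
    (J : ℝ → ℝ) (hJ : MollKernel2 J)
    (α : ℝ) (hα : α ∈ Set.Icc (0:ℝ) 1)
    (χ : ℝ → ℝ → Euc d) (hχ : IsIrrigPlan μ χ) :
    Tendsto (fun ε : ℝ => Etil μ J α ε χ) (𝓝[>] (0:ℝ)) (𝓝 (irrCost μ α χ)) := by
  refine (hJ.radialKernel.tendsto_Etil hα hχ).congr' ?_
  filter_upwards [self_mem_nhdsWithin] with ε hε
  exact Etil_congr (fun r hr => by simp [max_eq_left (Set.mem_Ici.1 hr)]) (le_of_lt hε) α

end
end

section
/- The alternative mollified irrigation cost is in general not lower semicontinuous: there exist d = 2, α ∈ [0,1), ε > 0, a smooth positive decreasing function J : ℝ₊ → ℝ₊ with 1 ≤ ∫₀^∞ J(r) dr < ∞, a positive Radon measure μ on ℝ² with bounded support, and a sequence of admissible irrigation plans χ_n ∈ IP(μ) converging to χ ∈ IP(μ), such that liminf_{n→∞} Ẽ^α_ε(χ_n) < Ẽ^α_ε(χ). -/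
open MeasureTheory Filter Topology
open scoped ENNReal NNReal

noncomputable section

/-- The first unit vector of the plane. -/
def unitVec : Euc 2 := EuclideanSpace.single 0 1

lemma norm_unitVec : ‖unitVec‖ = 1 := by simp [unitVec]

/-- The truncation of `t` to the interval `[0, T]`. -/
def clamp (T t : ℝ) : ℝ := max 0 (min T t)

lemma lipschitzWith_clamp (T : ℝ) : LipschitzWith 1 (clamp T) :=
  (LipschitzWith.id.const_min T).const_max 0

lemma clamp_zero {T : ℝ} (hT : 0 ≤ T) : clamp T 0 = 0 := by simp [clamp, hT]

lemma clamp_of_le {T t : ℝ} (hT : 0 ≤ T) (h : T ≤ t) : clamp T t = T := by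
  simp [clamp, h, hT]

lemma clamp_of_mem {T t : ℝ} (ht : t ∈ Set.Ioo 0 T) : clamp T t = t := by
  simp [clamp, ht.1.le, ht.2.le]

lemma abs_clamp_le {T : ℝ} (hT : 0 ≤ T) (t : ℝ) : |clamp T t| ≤ T := by
  rw [abs_of_nonneg (le_max_left _ _)]
  exact max_le hT (min_le_left _ _)

/-- The plan moving the particles in `(-∞, 4]` along the first axis according to `z` and the
other ones at unit speed from the origin to `8 • unitVec`. -/
def axisPlan (z : ℝ → ℝ) (θ t : ℝ) : Euc 2 :=
  (if θ ≤ 4 then z t else clamp 8 t) • unitVec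

/-- The final position of the particles of `axisPlan z` when `z` eventually vanishes. -/
def axisEnd (θ : ℝ) : Euc 2 := (if θ ≤ 4 then (0 : ℝ) else 8) • unitVec

/-- The irrigated measure of `axisPlan z`, namely `4 δ_0 + δ_{8 • unitVec}`. -/
def axisMeasure : Measure (Euc 2) := Measure.map axisEnd (volume.restrict (Set.Icc 0 5))

lemma axisPlan_of_le (z : ℝ → ℝ) {θ : ℝ} (h : θ ≤ 4) :
    axisPlan z θ = fun t => z t • unitVec := by
  funext t; simp [axisPlan, h]

lemma axisPlan_of_lt (z : ℝ → ℝ) {θ : ℝ} (h : 4 < θ) :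
    axisPlan z θ = fun t => clamp 8 t • unitVec := by
  funext t; simp [axisPlan, not_le.2 h]

lemma measurable_axisEnd : Measurable axisEnd :=
  (Measurable.ite measurableSet_Iic measurable_const measurable_const).smul_const _

lemma theta_axisMeasure : Theta axisMeasure = Set.Icc 0 5 := by
  simp [Theta, axisMeasure, Measure.map_apply measurable_axisEnd MeasurableSet.univ]

lemma isFiniteMeasure_axisMeasure : IsFiniteMeasure axisMeasure := by
  unfold axisMeasure; infer_instance

lemma axisMeasure_compl_closedBall : axisMeasure (Metric.closedBall 0 8)ᶜ = 0 := by
  rw [axisMeasure,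
    Measure.map_apply measurable_axisEnd Metric.isClosed_closedBall.measurableSet.compl]
  convert measure_empty (μ := volume.restrict (Set.Icc (0 : ℝ) 5))
  ext θ
  simp only [axisEnd, Set.mem_preimage, Set.mem_compl_iff, mem_closedBall_zero_iff, norm_smul,
    norm_unitVec, Set.mem_empty_iff_false, iff_false, not_not]
  split_ifs <;> norm_num

/-- A continuous path is at its eventual value at its stopping time. -/
lemma apply_stopTime {d : ℕ} {χ : ℝ → ℝ → Euc d} {θ T : ℝ} (hc : Continuous (χ θ)) (hT : 0 < T)
    (h : ∀ t ≥ T, χ θ t = χ θ T) : χ θ (stopTime χ θ) = χ θ T := by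
  have hcl : IsClosed {t | χ θ t = χ θ T} := isClosed_eq hc continuous_const
  have hsub : {t : ℝ | 0 < t ∧ ∀ t' ≥ t, χ θ t' = χ θ t} ⊆ {t | χ θ t = χ θ T} := by
    rintro t ⟨-, ht⟩
    have h₁ := ht (max t T) (le_max_left _ _)
    have h₂ := h (max t T) (le_max_right _ _)
    exact h₁.symm.trans h₂
  exact closure_minimal hsub hcl (csInf_mem_closure ⟨T, hT, h⟩ ⟨0, fun t ht => ht.1.le⟩)

lemma lipschitzWith_smul_unitVec {z : ℝ → ℝ} (hz : LipschitzWith 1 z) :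
    LipschitzWith 1 fun t => z t • unitVec := by
  refine LipschitzWith.of_dist_le_mul fun s t => ?_
  rw [dist_eq_norm, ← sub_smul, norm_smul, norm_unitVec, mul_one, ← dist_eq_norm]
  exact hz.dist_le_mul s t

lemma lipschitzWith_axisPlan {z : ℝ → ℝ} (hz : LipschitzWith 1 z) (θ : ℝ) :
    LipschitzWith 1 (axisPlan z θ) := by
  rcases le_or_gt θ 4 with h | h
  · rw [axisPlan_of_le z h]; exact lipschitzWith_smul_unitVec hz
  · rw [axisPlan_of_lt z h]; exact lipschitzWith_smul_unitVec (lipschitzWith_clamp 8)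

lemma axisPlan_eventually {z : ℝ → ℝ} {T : ℝ} (h : ∀ t ≥ T, z t = 0) (θ : ℝ) :
    ∀ t ≥ max T 8, axisPlan z θ t = axisEnd θ := by
  intro t ht
  rw [axisPlan, axisEnd, h t (le_of_max_le_left ht),
    clamp_of_le (by norm_num) (le_of_max_le_right ht)]

lemma isIrrigPlan_axisPlan {z : ℝ → ℝ} {T : ℝ} (hz : LipschitzWith 1 z) (h0 : z 0 = 0)
    (h : ∀ t ≥ T, z t = 0) : IsIrrigPlan axisMeasure (axisPlan z) where
  measurable := by
    have h₁ : Measurable fun p : ℝ × ℝ => if p.1 ≤ 4 then z p.2 else clamp 8 p.2 :=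
      Measurable.ite (measurableSet_le measurable_fst measurable_const)
        (hz.continuous.measurable.comp measurable_snd)
        ((lipschitzWith_clamp 8).continuous.measurable.comp measurable_snd)
    exact h₁.smul_const _
  lipschitz θ _ := lipschitzWith_axisPlan hz θ
  eventuallyConst θ _ := ⟨max T 8, by positivity, fun t ht => by
    rw [axisPlan_eventually h θ t ht, axisPlan_eventually h θ _ le_rfl]⟩
  init θ _ := by simp [axisPlan, h0, clamp_zero]
  pushforward := by
    rw [theta_axisMeasure, axisMeasure]
    congr 1
    funext θ
    have hT := axisPlan_eventually h θ
    rw [apply_stopTime (lipschitzWith_axisPlan hz θ).continuous (T := max T 8) (by positivity),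
      hT _ le_rfl]
    intro t ht
    rw [hT t ht, hT _ le_rfl]

lemma nnnorm_deriv_le_indicator {z : ℝ → ℝ} {T : ℝ} (hz : LipschitzWith 1 z)
    (h : ∀ t ≥ T, z t = z T) (t : ℝ) :
    (‖deriv (fun s => z s • unitVec) t‖₊ : ℝ≥0∞) ≤ (Set.Iic T).indicator 1 t := by
  by_cases ht : t ≤ T
  · have := norm_deriv_le_of_lipschitz (x₀ := t) (lipschitzWith_smul_unitVec hz)
    simp only [Set.indicator_of_mem (Set.mem_Iic.2 ht), Pi.one_apply]
    exact_mod_cast this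
  · have : (fun s => z s • unitVec) =ᶠ[𝓝 t] fun _ => z T • unitVec := by
      filter_upwards [lt_mem_nhds (not_le.1 ht)] with s hs
      rw [h s hs.le]
    simp [this.deriv_eq]

lemma lintegral_nnnorm_deriv_le {z : ℝ → ℝ} {T : ℝ} (hz : LipschitzWith 1 z)
    (h : ∀ t ≥ T, z t = z T) :
    ∫⁻ t in Set.Ici (0 : ℝ), (‖deriv (fun s => z s • unitVec) t‖₊ : ℝ≥0∞) ≤ ENNReal.ofReal T := by
  calc _ ≤ ∫⁻ t in Set.Ici (0 : ℝ), (Set.Iic T).indicator 1 t :=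
        lintegral_mono fun t => nnnorm_deriv_le_indicator hz h t
    _ = ENNReal.ofReal T := by
        rw [lintegral_indicator_one measurableSet_Iic, Measure.restrict_apply measurableSet_Iic,
          Set.inter_comm, Set.Ici_inter_Iic, Real.volume_Icc, sub_zero]

/-- The scalar path oscillating on `[0, π]` with amplitude `1 / k`. -/
def wave (k : ℕ) (t : ℝ) : ℝ := Real.sin (k * clamp Real.pi t) / k

lemma lipschitzWith_wave (k : ℕ) : LipschitzWith 1 (wave k) := by
  refine LipschitzWith.of_dist_le_mul fun s t => ?_
  rcases Nat.eq_zero_or_pos k with rfl | hk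
  · simp [wave]
  have hk' : (0 : ℝ) < k := by exact_mod_cast hk
  have h₁ := Real.lipschitzWith_sin.dist_le_mul (k * clamp Real.pi s) (k * clamp Real.pi t)
  have h₂ := (lipschitzWith_clamp Real.pi).dist_le_mul s t
  simp only [Real.dist_eq, NNReal.coe_one, one_mul, wave] at *
  rw [← sub_div, abs_div, abs_of_pos hk', div_le_iff₀ hk']
  rw [← mul_sub, abs_mul, abs_of_pos hk'] at h₁
  nlinarith

lemma wave_zero (k : ℕ) : wave k 0 = 0 := by simp [wave, clamp_zero Real.pi_pos.le]

lemma wave_of_pi_le (k : ℕ) {t : ℝ} (h : Real.pi ≤ t) : wave k t = 0 := by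
  simp [wave, clamp_of_le Real.pi_pos.le h, Real.sin_nat_mul_pi]

lemma abs_wave_le (k : ℕ) (t : ℝ) : |wave k t| ≤ 1 / k := by
  rw [wave, abs_div, Nat.abs_cast]
  gcongr
  exact Real.abs_sin_le_one _

lemma norm_deriv_wave {k : ℕ} (hk : k ≠ 0) {t : ℝ} (ht : t ∈ Set.Ioo 0 Real.pi) :
    ‖deriv (fun s => wave k s • unitVec) t‖ = |Real.cos (k * t)| := by
  have hk' : (k : ℝ) ≠ 0 := by exact_mod_cast hk
  have h₁ : HasDerivAt (fun s : ℝ => Real.sin (k * s) / k) (Real.cos (k * t)) t := by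
    have := ((Real.hasDerivAt_sin (k * t)).comp t ((hasDerivAt_id t).const_mul (k : ℝ))).div_const
      (k : ℝ)
    simpa [hk'] using this
  have h₂ : (fun s => wave k s • unitVec) =ᶠ[𝓝 t] fun s => (Real.sin (k * s) / k) • unitVec := by
    filter_upwards [isOpen_Ioo.mem_nhds ht] with s hs
    rw [wave, clamp_of_mem hs]
  rw [h₂.deriv_eq, (h₁.smul_const unitVec).deriv, norm_smul, norm_unitVec, mul_one,
    Real.norm_eq_abs]

lemma integral_cos_nat_mul_sq {k : ℕ} (hk : k ≠ 0) :
    ∫ t in (0 : ℝ)..Real.pi, Real.cos (k * t) ^ 2 = Real.pi / 2 := by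
  have hk' : (k : ℝ) ≠ 0 := by exact_mod_cast hk
  rw [intervalIntegral.integral_comp_mul_left (fun t => Real.cos t ^ 2) hk', integral_cos_sq]
  simp [Real.sin_nat_mul_pi]
  field_simp

/-- The kernel used for the counterexample. -/
def expKernel (r : ℝ) : ℝ := Real.exp (9 - r)

lemma mollKernel2_expKernel : MollKernel2 expKernel := by
  have hint : IntegrableOn (fun r => Real.exp (-r)) (Set.Ioi 0) volume := by
    simpa using integrableOn_exp_neg_Ioi 0
  have heq : expKernel = fun r => Real.exp 9 * Real.exp (-r) := by
    funext r; rw [expKernel, sub_eq_add_neg, Real.exp_add]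
  refine ⟨?_, fun r _ => Real.exp_pos _, fun r _ s _ h => ?_, ?_, ?_⟩
  · exact (Real.contDiff_exp.comp (contDiff_const.sub contDiff_id)).contDiffOn
  · exact Real.exp_lt_exp.2 (by linarith)
  · rw [heq]; exact hint.const_mul _
  · rw [heq, integral_const_mul, integral_exp_neg_Ioi_zero, mul_one]
    exact Real.one_le_exp (by norm_num)

lemma one_le_kernel_integral_wave {k : ℕ} (hk : k ≠ 0) {x : Euc 2} (hx : ‖x‖ ≤ 8) :
    1 ≤ ∫⁻ t in Set.Ici (0 : ℝ),
      ENNReal.ofReal ((1 / 1) * expKernel (dist (wave k t • unitVec) x / 1)) *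
        (‖deriv (fun s => wave k s • unitVec) t‖₊ : ℝ≥0∞) := by
  have hk' : (1 : ℝ) ≤ k := by exact_mod_cast Nat.one_le_iff_ne_zero.2 hk
  have hcont : Continuous fun t : ℝ => Real.cos (k * t) ^ 2 := by fun_prop
  calc (1 : ℝ≥0∞) ≤ ENNReal.ofReal (Real.pi / 2) :=
        ENNReal.one_le_ofReal.2 (by linarith [Real.pi_gt_three])
    _ = ∫⁻ t in Set.Ioo (0 : ℝ) Real.pi, ENNReal.ofReal (Real.cos (k * t) ^ 2) := by
        rw [← integral_cos_nat_mul_sq hk, intervalIntegral.integral_of_le Real.pi_pos.le,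
          ofReal_integral_eq_lintegral_ofReal, restrict_Ioo_eq_restrict_Ioc]
        · exact (hcont.intervalIntegrable 0 Real.pi).1
        · exact ae_of_all _ fun t => sq_nonneg _
    _ ≤ ∫⁻ t in Set.Ioo (0 : ℝ) Real.pi,
          ENNReal.ofReal ((1 / 1) * expKernel (dist (wave k t • unitVec) x / 1)) *
            (‖deriv (fun s => wave k s • unitVec) t‖₊ : ℝ≥0∞) := by
        refine setLIntegral_mono' measurableSet_Ioo fun t ht => ?_
        have hd : dist (wave k t • unitVec) x ≤ 9 := by
          have h₁ : |wave k t| ≤ 1 := (abs_wave_le k t).trans ((div_le_one (by linarith)).2 hk')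
          have h₂ := dist_le_norm_add_norm (wave k t • unitVec) x
          rw [norm_smul, norm_unitVec, mul_one, Real.norm_eq_abs] at h₂
          linarith
        have hJ : 1 ≤ (1 / 1) * expKernel (dist (wave k t • unitVec) x / 1) := by
          rw [div_one, div_one, one_mul]
          exact Real.one_le_exp (by linarith)
        have hcos : Real.cos (k * t) ^ 2 ≤ |Real.cos (k * t)| := by
          rw [← sq_abs, sq]
          exact mul_le_of_le_one_left (abs_nonneg _) (Real.abs_cos_le_one _)
        rw [← enorm_eq_nnnorm, ← ofReal_norm, norm_deriv_wave hk ht]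
        calc _ ≤ 1 * ENNReal.ofReal |Real.cos (k * t)| := by
              rw [one_mul]; exact ENNReal.ofReal_le_ofReal hcos
          _ ≤ _ := by gcongr; exact ENNReal.one_le_ofReal.2 hJ
    _ ≤ _ := lintegral_mono_set fun t ht => ht.1.le

lemma four_le_Wtil_wave {k : ℕ} (hk : k ≠ 0) {x : Euc 2} (hx : ‖x‖ ≤ 8) :
    4 ≤ Wtil axisMeasure expKernel 1 (axisPlan (wave k)) x := by
  rw [Wtil, theta_axisMeasure]
  calc (4 : ℝ≥0∞) = ∫⁻ _ in Set.Icc (0 : ℝ) 4, 1 := by simp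
    _ ≤ ∫⁻ θ in Set.Icc (0 : ℝ) 4, min 1 (∫⁻ t in Set.Ici (0 : ℝ),
          ENNReal.ofReal ((1 / 1) * expKernel (dist (axisPlan (wave k) θ t) x / 1)) *
            (‖deriv (axisPlan (wave k) θ) t‖₊ : ℝ≥0∞)) := by
        refine setLIntegral_mono' measurableSet_Icc fun θ hθ => ?_
        rw [axisPlan_of_le _ hθ.2]
        exact le_min le_rfl (one_le_kernel_integral_wave hk hx)
    _ ≤ _ := lintegral_mono_set (Set.Icc_subset_Icc_right (by norm_num))

lemma norm_axisPlan_wave_le {k : ℕ} (hk : k ≠ 0) (θ t : ℝ) :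
    ‖axisPlan (wave k) θ t‖ ≤ 8 := by
  have hk' : (1 : ℝ) ≤ k := by exact_mod_cast Nat.one_le_iff_ne_zero.2 hk
  rw [axisPlan, norm_smul, norm_unitVec, mul_one, Real.norm_eq_abs]
  split_ifs
  · have h₁ : |wave k t| ≤ 1 := (abs_wave_le k t).trans ((div_le_one (by linarith)).2 hk')
    linarith
  · exact abs_clamp_le (by norm_num) t

lemma lintegral_deriv_axisPlan_wave_le (k : ℕ) (θ : ℝ) :
    ∫⁻ t in Set.Ici (0 : ℝ), (‖deriv (axisPlan (wave k) θ) t‖₊ : ℝ≥0∞) ≤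
      4 * (1 + (Set.Ioi (4 : ℝ)).indicator 1 θ) := by
  rcases le_or_gt θ 4 with h | h
  · rw [axisPlan_of_le _ h, Set.indicator_of_notMem (by simpa using h), add_zero, mul_one]
    refine (lintegral_nnnorm_deriv_le (T := 4) (lipschitzWith_wave k) fun t ht => ?_).trans
      (by simp)
    rw [wave_of_pi_le k (Real.pi_le_four.trans ht), wave_of_pi_le k Real.pi_le_four]
  · rw [axisPlan_of_lt _ h, Set.indicator_of_mem (Set.mem_Ioi.2 h), Pi.one_apply]
    refine (lintegral_nnnorm_deriv_le (T := 8) (lipschitzWith_clamp 8) fun t ht => ?_).trans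
      (by norm_num)
    rw [clamp_of_le (by norm_num) ht, clamp_of_le (by norm_num) le_rfl]

lemma Etil_wave_le {k : ℕ} (hk : k ≠ 0) :
    Etil axisMeasure expKernel 0 1 (axisPlan (wave k)) ≤ 6 := by
  rw [Etil, theta_axisMeasure]
  calc _ ≤ ∫⁻ θ in Set.Icc (0 : ℝ) 5, (1 + (Set.Ioi (4 : ℝ)).indicator 1 θ) := by
        refine lintegral_mono fun θ => ?_
        calc _ ≤ ∫⁻ t in Set.Ici (0 : ℝ),
                (4 : ℝ≥0∞)⁻¹ * (‖deriv (axisPlan (wave k) θ) t‖₊ : ℝ≥0∞) := by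
              refine lintegral_mono fun t => ?_
              rw [zero_sub, ENNReal.rpow_neg_one]
              gcongr
              exact four_le_Wtil_wave hk (norm_axisPlan_wave_le hk θ t)
          _ = (4 : ℝ≥0∞)⁻¹ * ∫⁻ t in Set.Ici (0 : ℝ),
                (‖deriv (axisPlan (wave k) θ) t‖₊ : ℝ≥0∞) :=
              lintegral_const_mul' _ _ (by simp)
          _ ≤ (4 : ℝ≥0∞)⁻¹ * (4 * (1 + (Set.Ioi (4 : ℝ)).indicator 1 θ)) := by
              gcongr
              exact lintegral_deriv_axisPlan_wave_le k θ
          _ = _ := by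
              rw [← mul_assoc, ENNReal.inv_mul_cancel (by simp) (by simp), one_mul]
    _ = 6 := by
        have hI : Set.Ioi (4 : ℝ) ∩ Set.Icc 0 5 = Set.Ioc 4 5 := by
          ext θ
          simp only [Set.mem_inter_iff, Set.mem_Ioi, Set.mem_Icc, Set.mem_Ioc]
          constructor
          · rintro ⟨h₁, -, h₂⟩; exact ⟨h₁, h₂⟩
          · rintro ⟨h₁, h₂⟩; exact ⟨h₁, by linarith, h₂⟩
        rw [lintegral_add_left measurable_const, lintegral_indicator_one measurableSet_Ioi,
          Measure.restrict_apply measurableSet_Ioi, hI]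
        norm_num

lemma Wtil_axisPlan_zero_le (x : Euc 2) :
    Wtil axisMeasure expKernel 1 (axisPlan 0) x ≤ 1 := by
  rw [Wtil, theta_axisMeasure]
  calc _ ≤ ∫⁻ θ in Set.Icc (0 : ℝ) 5, (Set.Ioi (4 : ℝ)).indicator 1 θ := by
        refine lintegral_mono fun θ => ?_
        rcases le_or_gt θ 4 with h | h
        · simp [axisPlan_of_le _ h]
        · rw [Set.indicator_of_mem (Set.mem_Ioi.2 h)]
          exact min_le_left _ _
    _ ≤ volume (Set.Ioc (4 : ℝ) 5) := by
        rw [lintegral_indicator_one measurableSet_Ioi, Measure.restrict_apply measurableSet_Ioi]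
        exact measure_mono fun θ hθ => ⟨hθ.1, hθ.2.2⟩
    _ = 1 := by norm_num

lemma norm_deriv_clamp {T t : ℝ} (ht : t ∈ Set.Ioo 0 T) :
    ‖deriv (fun s => clamp T s • unitVec) t‖ = 1 := by
  have h : (fun s => clamp T s • unitVec) =ᶠ[𝓝 t] fun s => s • unitVec := by
    filter_upwards [isOpen_Ioo.mem_nhds ht] with s hs
    rw [clamp_of_mem hs]
  rw [h.deriv_eq, ((hasDerivAt_id' t).smul_const unitVec).deriv, one_smul, norm_unitVec]

lemma eight_le_Etil_axisPlan_zero : 8 ≤ Etil axisMeasure expKernel 0 1 (axisPlan 0) := by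
  rw [Etil, theta_axisMeasure]
  calc (8 : ℝ≥0∞) = ∫⁻ _ in Set.Ioc (4 : ℝ) 5, 8 := by norm_num
    _ ≤ ∫⁻ θ in Set.Ioc (4 : ℝ) 5, ∫⁻ t in Set.Ici (0 : ℝ),
          (Wtil axisMeasure expKernel 1 (axisPlan 0) (axisPlan 0 θ t)) ^ ((0 : ℝ) - 1) *
            (‖deriv (axisPlan 0 θ) t‖₊ : ℝ≥0∞) := by
        refine setLIntegral_mono' measurableSet_Ioc fun θ hθ => ?_
        calc (8 : ℝ≥0∞) = ∫⁻ _ in Set.Ioo (0 : ℝ) 8, 1 := by simp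
          _ ≤ ∫⁻ t in Set.Ioo (0 : ℝ) 8,
                (Wtil axisMeasure expKernel 1 (axisPlan 0) (axisPlan 0 θ t)) ^ ((0 : ℝ) - 1) *
                  (‖deriv (axisPlan 0 θ) t‖₊ : ℝ≥0∞) := by
              refine setLIntegral_mono' measurableSet_Ioo fun t ht => ?_
              rw [← enorm_eq_nnnorm, ← ofReal_norm, axisPlan_of_lt 0 hθ.1, norm_deriv_clamp ht,
                ENNReal.ofReal_one, mul_one, zero_sub, ENNReal.rpow_neg_one]
              exact ENNReal.one_le_inv.2 (Wtil_axisPlan_zero_le _)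
          _ ≤ _ := lintegral_mono_set fun t ht => ht.1.le
    _ ≤ _ := lintegral_mono_set
        (Set.Ioc_subset_Icc_self.trans (Set.Icc_subset_Icc_left (by norm_num)))

lemma dPath_nonneg {d : ℕ} (γ₀ γ₁ : ℝ → Euc d) : 0 ≤ dPath γ₀ γ₁ :=
  Real.iSup_nonneg fun _ => mul_nonneg (by positivity) (Real.iSup_nonneg fun _ => dist_nonneg)

lemma dPath_le {d : ℕ} {γ₀ γ₁ : ℝ → Euc d} {c : ℝ} (hc : 0 ≤ c)
    (h : ∀ t, dist (γ₀ t) (γ₁ t) ≤ c) : dPath γ₀ γ₁ ≤ c := by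
  refine Real.iSup_le (fun k => ?_) hc
  have h₁ : (1 : ℝ) ≤ ((k : ℕ) : ℝ) := by exact_mod_cast k.pos
  have h₂ : 1 / ((k : ℕ) : ℝ) ≤ 1 := (div_le_one (by linarith)).2 h₁
  calc _ ≤ 1 / ((k : ℕ) : ℝ) * c := by
        gcongr; exact Real.iSup_le (fun t => h t) hc
    _ ≤ c := mul_le_of_le_one_left hc h₂

lemma dist_axisPlan_wave_zero_le (k : ℕ) (θ t : ℝ) :
    dist (axisPlan (wave k) θ t) (axisPlan 0 θ t) ≤ 1 / k := by
  rcases le_or_gt θ 4 with h | h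
  · simp only [axisPlan_of_le _ h, Pi.zero_apply, zero_smul, dist_zero_right, norm_smul,
      norm_unitVec, mul_one, Real.norm_eq_abs]
    exact abs_wave_le k t
  · simp [axisPlan_of_lt _ h]

lemma plansTendsto_axisPlan_wave :
    PlansTendsto axisMeasure (fun n => axisPlan (wave (n + 1))) (axisPlan 0) := by
  refine ae_of_all _ fun θ => squeeze_zero (fun n => dPath_nonneg _ _) (fun n => ?_)
    tendsto_one_div_add_atTop_nhds_zero_nat
  refine dPath_le (by positivity) fun t => ?_
  exact_mod_cast dist_axisPlan_wave_zero_le (n + 1) θ t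

/-- the alternative mollified irrigation cost is in general not
lower semicontinuous. -/
theorem alt_mollified_cost_not_lsc :
    ∃ (α ε : ℝ) (J : ℝ → ℝ) (μ : Measure (Euc 2))
      (χs : ℕ → ℝ → ℝ → Euc 2) (χ : ℝ → ℝ → Euc 2),
      α ∈ Set.Ico (0:ℝ) 1 ∧ 0 < ε ∧ MollKernel2 J ∧
      IsFiniteMeasure μ ∧ (∃ R : ℝ, μ (Metric.closedBall 0 R)ᶜ = 0) ∧
      (∀ n, IsIrrigPlan μ (χs n)) ∧ IsIrrigPlan μ χ ∧ PlansTendsto μ χs χ ∧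
      Filter.liminf (fun n => Etil μ J α ε (χs n)) atTop < Etil μ J α ε χ := by
  refine ⟨0, 1, expKernel, axisMeasure, fun n => axisPlan (wave (n + 1)), axisPlan 0,
    by simp, one_pos, mollKernel2_expKernel, isFiniteMeasure_axisMeasure,
    ⟨8, axisMeasure_compl_closedBall⟩, fun n => ?_, ?_, plansTendsto_axisPlan_wave, ?_⟩
  · exact isIrrigPlan_axisPlan (lipschitzWith_wave _) (wave_zero _) fun t => wave_of_pi_le _
  · exact isIrrigPlan_axisPlan (T := 0) (LipschitzWith.const' (0 : ℝ)) rfl fun _ _ => rfl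
  · calc _ ≤ liminf (fun _ : ℕ => (6 : ℝ≥0∞)) atTop :=
          liminf_le_liminf (Eventually.of_forall fun n => Etil_wave_le n.succ_ne_zero)
      _ = 6 := liminf_const 6
      _ < 8 := by norm_num
      _ ≤ _ := eight_le_Etil_axisPlan_zero

end
end
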